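/- Two horizontal loops in the standard Engel space (ℝ⁴, 𝒟) are horizontally isotopic if and only if their rotation numbers agree. Precisely: if γ₀, γ₁ : ℝ → ℝ⁴ are horizontal loops, then there exists a horizontal isotopy from γ₀ to γ₁ if and only if rot(γ₀) = rot(γ₁). -/

import Mathlib

/-- A horizontal loop in the standard Engel space `(ℝ⁴, 𝒟)`, where
`𝒟 = ker(dz - y dx) ∩ ker(dw - z dx)`: a smooth 1-periodic curve
`γ = (x,y,z,w)` with nowhere-vanishing derivative, injective modulo the
period, tangent to `𝒟`, i.e. `z' = y·x'` and `w' = z·x'`. -/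
structure IsHorizontalLoop (γ : ℝ → ℝ × ℝ × ℝ × ℝ) : Prop where
  smooth : ContDiff ℝ (⊤ : ℕ∞) γ
  periodic : Function.Periodic γ 1
  immersed : ∀ s : ℝ, deriv γ s ≠ 0
  tangent_z : ∀ s : ℝ, deriv (fun t => (γ t).2.2.1) s
      = (γ s).2.1 * deriv (fun t => (γ t).1) s
  tangent_w : ∀ s : ℝ, deriv (fun t => (γ t).2.2.2) s
      = (γ s).2.2.1 * deriv (fun t => (γ t).1) s
  injOnPeriod : ∀ s₀ s₁ : ℝ, γ s₀ = γ s₁ → ∃ k : ℤ, s₁ - s₀ = (k : ℝ)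

/-- `rot(γ) = n`: the winding number of `s ↦ (x'(s), y'(s))` around the origin
over one period equals `n`, expressed via a continuous angle function `θ`. -/
def HasRotationNumber (γ : ℝ → ℝ × ℝ × ℝ × ℝ) (n : ℤ) : Prop :=
  ∃ θ : ℝ → ℝ, Continuous θ ∧
    (∀ s : ℝ,
      deriv (fun t => (γ t).1) s
        = Real.sqrt ((deriv (fun t => (γ t).1) s) ^ 2
            + (deriv (fun t => (γ t).2.1) s) ^ 2) * Real.cos (θ s) ∧
      deriv (fun t => (γ t).2.1) s
        = Real.sqrt ((deriv (fun t => (γ t).1) s) ^ 2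
            + (deriv (fun t => (γ t).2.1) s) ^ 2) * Real.sin (θ s)) ∧
    θ 1 - θ 0 = 2 * Real.pi * (n : ℝ)

/-- A horizontal isotopy: a smooth map `H : [0,1] × ℝ → ℝ⁴` such that each
`H t` (for `t ∈ [0,1]`) is a horizontal loop. -/
def IsHorizontalIsotopy (H : ℝ → ℝ → ℝ × ℝ × ℝ × ℝ) : Prop :=
  ContDiffOn ℝ (⊤ : ℕ∞) (Function.uncurry H) (Set.Icc (0:ℝ) 1 ×ˢ (Set.univ : Set ℝ)) ∧
  ∀ t ∈ Set.Icc (0:ℝ) 1, IsHorizontalLoop (H t)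

section

open Set Filter Topology MeasureTheory intervalIntegral
open scoped ContDiff

section ParametricIntegrals

variable {E : Type} [NormedAddCommGroup E] [NormedSpace ℝ E] [FiniteDimensional ℝ E]

theorem hasFDerivAt_integral_of_contDiff {G : Type} [NormedAddCommGroup G] [NormedSpace ℝ G]
    {f : E × ℝ → G} (hf : ContDiff ℝ 1 f) (e : E) :
    HasFDerivAt (fun e => ∫ u in (0 : ℝ)..1, f (e, u))
      (∫ u in (0 : ℝ)..1, (fderiv ℝ f (e, u)).comp (ContinuousLinearMap.inl ℝ E ℝ)) e := by
  have hc : Continuous fun p : E × ℝ => (fderiv ℝ f p).comp (ContinuousLinearMap.inl ℝ E ℝ) :=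
    (hf.continuous_fderiv one_ne_zero).clm_comp continuous_const
  have hK : IsCompact (Metric.closedBall e 1 ×ˢ Icc (0 : ℝ) 1) :=
    (isCompact_closedBall e 1).prod isCompact_Icc
  obtain ⟨C, hC⟩ := hK.exists_bound_of_continuousOn hc.continuousOn
  refine hasFDerivAt_integral_of_dominated_of_fderiv_le (𝕜 := ℝ) (bound := fun _ => C)
    (F' := fun e u => (fderiv ℝ f (e, u)).comp (ContinuousLinearMap.inl ℝ E ℝ))
    (Metric.closedBall_mem_nhds e one_pos) ?_ ?_ ?_ ?_ ?_ ?_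
  · exact Eventually.of_forall fun x =>
      (hf.continuous.comp (by fun_prop : Continuous fun u : ℝ => (x, u))).aestronglyMeasurable
  · exact (hf.continuous.comp (by fun_prop : Continuous fun u : ℝ => (e, u))).intervalIntegrable ..
  · exact (hc.comp (by fun_prop : Continuous fun u : ℝ => (e, u))).aestronglyMeasurable
  · refine Eventually.of_forall fun u hu x hx => hC (x, u) ⟨hx, ?_⟩
    rw [uIoc_of_le zero_le_one] at hu
    exact ⟨hu.1.le, hu.2⟩
  · exact intervalIntegrable_const
  · refine Eventually.of_forall fun u _ x _ => ?_
    have h1 : HasFDerivAt (fun x : E => (x, u)) (ContinuousLinearMap.inl ℝ E ℝ) x :=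
      hasFDerivAt_prodMk_left x u
    exact ((hf.differentiable one_ne_zero).differentiableAt.hasFDerivAt).comp x h1

theorem contDiff_integral_nat (n : ℕ) {G : Type} [NormedAddCommGroup G] [NormedSpace ℝ G]
    {f : E × ℝ → G} (hf : ContDiff ℝ n f) :
    ContDiff ℝ n fun e => ∫ u in (0 : ℝ)..1, f (e, u) := by
  induction n generalizing G with
  | zero =>
    rw [Nat.cast_zero, contDiff_zero] at hf ⊢
    exact continuous_parametric_intervalIntegral_of_continuous' (f := fun e u => f (e, u)) hf 0 1
  | succ n ih =>
    have h1 : ContDiff ℝ 1 f := hf.of_le (by exact_mod_cast Nat.le_add_left 1 n)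
    have hd := fun e => hasFDerivAt_integral_of_contDiff h1 e
    rw [Nat.cast_succ, contDiff_succ_iff_fderiv]
    refine ⟨fun e => (hd e).differentiableAt, by simp, ?_⟩
    rw [show fderiv ℝ (fun e => ∫ u in (0 : ℝ)..1, f (e, u)) = _ from
      funext fun e => (hd e).fderiv]
    refine ih (f := fun p => (fderiv ℝ f p).comp (ContinuousLinearMap.inl ℝ E ℝ)) ?_
    exact (hf.fderiv_right (by norm_cast)).clm_comp contDiff_const

/-- Integrals of smooth functions over `[0, s]` depend smoothly on parameters and on `s`. -/
theorem contDiff_integral {f : E × ℝ → ℝ} (hf : ContDiff ℝ ∞ f) :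
    ContDiff ℝ ∞ fun p : E × ℝ => ∫ u in (0 : ℝ)..p.2, f (p.1, u) := by
  have h : (fun p : E × ℝ => ∫ u in (0 : ℝ)..p.2, f (p.1, u)) =
      fun p : E × ℝ => p.2 * ∫ u in (0 : ℝ)..1, f (p.1, p.2 * u) := by
    funext p
    simpa using (mul_integral_comp_mul_left (a := 0) (b := 1) (f := fun u => f (p.1, u)) p.2).symm
  rw [h, contDiff_infty]
  intro n
  refine contDiff_snd.mul (contDiff_integral_nat n (f := fun q : (E × ℝ) × ℝ =>
    f (q.1.1, q.1.2 * q.2)) ?_)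
  exact (contDiff_infty.1 hf n).comp (by fun_prop)

end ParametricIntegrals

section ParametricDerivatives

variable {E : Type} [NormedAddCommGroup E] [NormedSpace ℝ E]

theorem deriv_eq_fderiv_prod {G : Type} [NormedAddCommGroup G] [NormedSpace ℝ G]
    {f : E → ℝ → G} (hf : ContDiff ℝ ∞ (Function.uncurry f))
    (e : E) (s : ℝ) : deriv (f e) s = fderiv ℝ (Function.uncurry f) (e, s) (0, 1) := by
  have h2 : HasFDerivAt (Function.uncurry f) (fderiv ℝ (Function.uncurry f) (e, s)) (e, s) :=
    (hf.differentiable (by simp)).differentiableAt.hasFDerivAt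
  have h1 : HasDerivAt (fun u : ℝ => (e, u)) ((0 : E), (1 : ℝ)) s :=
    (hasDerivAt_const s e).prodMk (hasDerivAt_id s)
  exact (h2.comp_hasDerivAt s h1).deriv

theorem contDiff_deriv_param {G : Type} [NormedAddCommGroup G] [NormedSpace ℝ G]
    {f : E → ℝ → G} (hf : ContDiff ℝ ∞ (Function.uncurry f)) :
    ContDiff ℝ ∞ fun p : E × ℝ => deriv (f p.1) p.2 := by
  simp_rw [fun p : E × ℝ => deriv_eq_fderiv_prod hf p.1 p.2]
  exact (hf.fderiv_right (m := ∞) (by simp)).clm_apply contDiff_const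

end ParametricDerivatives

section Transversality

/-- The regular zeros of a map `E → G` form a set of dimension at most `dim E - dim G`. -/
theorem dimH_regular_zeros_le {E G : Type*} [NormedAddCommGroup E] [NormedSpace ℝ E]
    [FiniteDimensional ℝ E] [NormedAddCommGroup G] [NormedSpace ℝ G] [FiniteDimensional ℝ G]
    {F : E → G} {F' : E → E →L[ℝ] G} {Z : Set E} {d : ℕ}
    (hd : Module.finrank ℝ E = d + Module.finrank ℝ G)
    (hF : ∀ a ∈ Z, HasStrictFDerivAt F (F' a) a) (h0 : ∀ a ∈ Z, F a = 0)
    (hs : ∀ a ∈ Z, Function.Surjective (F' a)) : dimH Z ≤ d := by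
  rw [← bsupr_limsup_dimH]
  refine iSup₂_le fun a ha => ?_
  have hr : (F' a).range = ⊤ := LinearMap.range_eq_top.2 (hs a ha)
  have hst := (hF a ha)
  set φ := hst.implicitFunction F (F' a) hr (F a)
  obtain ⟨K, V, hV, hLip⟩ := (hst.to_implicitFunction hr).exists_lipschitzOnWith
  have hker : Module.finrank ℝ (F' a).ker = d := by
    have := LinearMap.finrank_range_add_finrank_ker (F' a).toLinearMap
    rw [show LinearMap.range (F' a).toLinearMap = ⊤ from hr, finrank_top] at this
    change _ + Module.finrank ℝ (F' a).ker = _ at this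
    omega
  have hcont : ContinuousAt (fun x => (hst.implicitToOpenPartialHomeomorph F (F' a) hr x).2) a :=
    ((hst.implicitToOpenPartialHomeomorph F (F' a) hr).continuousAt
      (hst.mem_implicitToOpenPartialHomeomorph_source hr)).snd
  have hV' : ∀ᶠ x in 𝓝 a, (hst.implicitToOpenPartialHomeomorph F (F' a) hr x).2 ∈ V := by
    apply hcont
    simpa using hV
  have hW : {x | x ∈ Z → x ∈ φ '' V} ∈ 𝓝 a := by
    filter_upwards [hV', hst.eq_implicitFunction hr] with x hx hx2 hxZ
    refine ⟨_, hx, ?_⟩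
    rw [show φ = hst.implicitFunction F (F' a) hr (F x) by rw [h0 x hxZ]; simp only [φ, h0 a ha]]
    exact hx2
  have hmem : Z ∩ {x | x ∈ Z → x ∈ φ '' V} ∈ 𝓝[Z] a :=
    inter_mem self_mem_nhdsWithin (mem_nhdsWithin_of_mem_nhds hW)
  refine limsup_le_of_le (h := ?_)
  rw [eventually_smallSets]
  refine ⟨_, hmem, fun t ht => ?_⟩
  calc dimH t ≤ dimH (φ '' V) := dimH_mono fun x hx => (ht hx).2 (ht hx).1
    _ ≤ dimH V := hLip.dimH_image_le
    _ ≤ dimH (univ : Set (F' a).ker) := dimH_mono (subset_univ _)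
    _ = d := by rw [Real.dimH_univ_eq_finrank, hker]

end Transversality

/-- The moment `∫ y xᵏ dx` of a plane curve `(x, y)` over `[a, b]`. -/
noncomputable def moment (k : ℕ) (x y : ℝ → ℝ) (a b : ℝ) : ℝ :=
  ∫ u in a..b, y u * x u ^ k * deriv x u

/-- The functions `xʲ (x')³` along which the second coordinate of a plane curve is corrected. -/
noncomputable def corrector (j : ℕ) (x : ℝ → ℝ) (s : ℝ) : ℝ := x s ^ j * deriv x s ^ 3

/-- The Gram determinant of `(x')²` and `x (x')²` over one period. -/
noncomputable def gramDet (x : ℝ → ℝ) : ℝ :=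
  moment 0 x (corrector 0 x) 0 1 * moment 1 x (corrector 1 x) 0 1
    - moment 1 x (corrector 0 x) 0 1 ^ 2

noncomputable def coeffZero (x y : ℝ → ℝ) : ℝ :=
  (moment 0 x y 0 1 * moment 1 x (corrector 1 x) 0 1
    - moment 1 x y 0 1 * moment 1 x (corrector 0 x) 0 1) / gramDet x

noncomputable def coeffOne (x y : ℝ → ℝ) : ℝ :=
  (moment 0 x (corrector 0 x) 0 1 * moment 1 x y 0 1
    - moment 1 x (corrector 0 x) 0 1 * moment 0 x y 0 1) / gramDet x

/-- The projection of `y` to the functions whose zeroth and first moments over a period vanish. -/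
noncomputable def balance (x y : ℝ → ℝ) (s : ℝ) : ℝ :=
  y s - coeffZero x y * corrector 0 x s - coeffOne x y * corrector 1 x s

section Moments

variable {x y : ℝ → ℝ}

theorem contDiff_deriv (hx : ContDiff ℝ ∞ x) : ContDiff ℝ ∞ (deriv x) :=
  (contDiff_infty_iff_deriv.1 hx).2

theorem contDiff_corrector (hx : ContDiff ℝ ∞ x) (j : ℕ) : ContDiff ℝ ∞ (corrector j x) :=
  (hx.pow j).mul ((contDiff_deriv hx).pow 3)

theorem contDiff_balance (hx : ContDiff ℝ ∞ x) (hy : ContDiff ℝ ∞ y) :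
    ContDiff ℝ ∞ (balance x y) :=
  (hy.sub (contDiff_const.mul (contDiff_corrector hx 0))).sub
    (contDiff_const.mul (contDiff_corrector hx 1))

theorem continuous_moment_integrand (k : ℕ) (hx : ContDiff ℝ ∞ x) (hy : Continuous y) :
    Continuous fun u => y u * x u ^ k * deriv x u :=
  (hy.mul (hx.continuous.pow k)).mul (contDiff_deriv hx).continuous

theorem moment_corrector_eq (k j : ℕ) (x : ℝ → ℝ) (a b : ℝ) :
    moment k x (corrector j x) a b = ∫ u in a..b, x u ^ (j + k) * deriv x u ^ 4 := by
  unfold moment corrector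
  congr 1
  ext u
  ring

theorem moment_add_mul (k : ℕ) (hx : ContDiff ℝ ∞ x) {y₁ y₂ : ℝ → ℝ} (hy₁ : Continuous y₁)
    (hy₂ : Continuous y₂) (c a b : ℝ) :
    moment k x (fun s => y₁ s + c * y₂ s) a b = moment k x y₁ a b + c * moment k x y₂ a b := by
  unfold moment
  rw [← intervalIntegral.integral_const_mul, ← intervalIntegral.integral_add]
  · congr 1
    ext u
    ring
  · exact (continuous_moment_integrand k hx hy₁).intervalIntegrable _ _
  · exact ((continuous_moment_integrand k hx hy₂).const_mul c).intervalIntegrable _ _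

theorem moment_balance (k : ℕ) (hx : ContDiff ℝ ∞ x) (hy : Continuous y) (a b : ℝ) :
    moment k x (balance x y) a b = moment k x y a b
      - coeffZero x y * moment k x (corrector 0 x) a b
      - coeffOne x y * moment k x (corrector 1 x) a b := by
  have h0 := (contDiff_corrector hx 0).continuous
  have h1 := (contDiff_corrector hx 1).continuous
  have e : balance x y = fun s => (y s + (-coeffZero x y) * corrector 0 x s)
      + (-coeffOne x y) * corrector 1 x s := by
    funext s; unfold balance; ring
  have hc : Continuous fun s => y s + (-coeffZero x y) * corrector 0 x s :=
    hy.add (h0.const_mul _)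
  rw [e, moment_add_mul k hx hc h1, moment_add_mul k hx hy h0]
  ring

theorem moment_zero_balance (hx : ContDiff ℝ ∞ x) (hy : Continuous y) (hD : gramDet x ≠ 0) :
    moment 0 x (balance x y) 0 1 = 0 := by
  rw [moment_balance 0 hx hy, show moment 0 x (corrector 1 x) 0 1 = moment 1 x (corrector 0 x) 0 1
    by simp only [moment_corrector_eq]]
  unfold coeffZero coeffOne
  field_simp
  unfold gramDet
  ring

theorem moment_one_balance (hx : ContDiff ℝ ∞ x) (hy : Continuous y) (hD : gramDet x ≠ 0) :
    moment 1 x (balance x y) 0 1 = 0 := by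
  rw [moment_balance 1 hx hy]
  unfold coeffZero coeffOne
  field_simp
  unfold gramDet
  ring

theorem balance_eq_self (h0 : moment 0 x y 0 1 = 0) (h1 : moment 1 x y 0 1 = 0) :
    balance x y = y := by
  funext s
  simp [balance, coeffZero, coeffOne, h0, h1]

theorem deriv_balance_of_deriv_eq_zero (hx : ContDiff ℝ ∞ x) (hy : ContDiff ℝ ∞ y) {s : ℝ}
    (hs : deriv x s = 0) : deriv (balance x y) s = deriv y s := by
  have hc : ∀ j, HasDerivAt (corrector j x) 0 s := fun j => by
    have h1 : HasDerivAt x (deriv x s) s := (hx.differentiable (by simp) s).hasDerivAt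
    have h2 := ((contDiff_deriv hx).differentiable (by simp) s).hasDerivAt
    convert! (h1.fun_pow j).mul (h2.fun_pow 3) using 1
    simp [hs]
  have := ((hy.differentiable (by simp) s).hasDerivAt.sub ((hc 0).const_mul (coeffZero x y))).sub
    ((hc 1).const_mul (coeffOne x y))
  exact (show deriv (balance x y) s = _ from this.deriv).trans (by simp)

theorem hasDerivAt_moment (k : ℕ) (hx : ContDiff ℝ ∞ x) (hy : Continuous y) (a s : ℝ) :
    HasDerivAt (fun s => moment k x y a s) (y s * x s ^ k * deriv x s) s :=
  ((continuous_moment_integrand k hx hy).integral_hasStrictDerivAt a s).hasDerivAt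

theorem moment_sub (k : ℕ) (hx : ContDiff ℝ ∞ x) (hy : Continuous y) (a b c : ℝ) :
    moment k x y a c - moment k x y a b = moment k x y b c :=
  integral_interval_sub_left ((continuous_moment_integrand k hx hy).intervalIntegrable _ _)
    ((continuous_moment_integrand k hx hy).intervalIntegrable _ _)

/-- Positivity of the weighted Gram determinant of `(x')²` and `x (x')²`. -/
theorem gram_pos {g : ℝ → ℝ} (hx : ContDiff ℝ ∞ x) (hg : Continuous g) (hg0 : ∀ s, 0 ≤ g s)
    {a b c : ℝ} (hc : c ∈ Ioo a b) (hgc : 0 < g c) (hxc : deriv x c ≠ 0) :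
    0 < (∫ u in a..b, g u * deriv x u ^ 4) * (∫ u in a..b, g u * x u ^ 2 * deriv x u ^ 4)
      - (∫ u in a..b, g u * x u * deriv x u ^ 4) ^ 2 := by
  have hab : a < b := hc.1.trans hc.2
  have hx' := (contDiff_deriv hx).continuous
  have hxc' := hx.continuous
  set A0 := ∫ u in a..b, g u * deriv x u ^ 4
  set A1 := ∫ u in a..b, g u * x u * deriv x u ^ 4
  set A2 := ∫ u in a..b, g u * x u ^ 2 * deriv x u ^ 4
  have hA0 : 0 < A0 := by
    refine integral_pos hab (by fun_prop) (fun u _ => mul_nonneg (hg0 u) (by positivity))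
      ⟨c, ⟨hc.1.le, hc.2.le⟩, by positivity⟩
  have hm : ∀ m : ℝ, 0 < ∫ u in a..b, g u * (x u - m) ^ 2 * deriv x u ^ 4 := fun m => by
    have h1 : ∀ᶠ u in 𝓝[≠] c, x u ≠ m :=
      (hx.differentiable (by simp) c).hasDerivAt.eventually_ne hxc
    have h2 : ∀ᶠ u in 𝓝 c, 0 < g u := hg.continuousAt.eventually (lt_mem_nhds hgc)
    have h3 : ∀ᶠ u in 𝓝 c, deriv x u ≠ 0 := hx'.continuousAt.eventually_ne hxc
    have h4 : ∀ᶠ u in 𝓝 c, u ∈ Ioo a b := Ioo_mem_nhds hc.1 hc.2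
    obtain ⟨u, hu1, hu2, hu3, hu4⟩ :=
      (h1.and ((h2.and (h3.and h4)).filter_mono nhdsWithin_le_nhds)).exists
    refine integral_pos hab (by fun_prop)
      (fun u _ => mul_nonneg (mul_nonneg (hg0 u) (by positivity)) (by positivity))
      ⟨u, ⟨hu4.1.le, hu4.2.le⟩, ?_⟩
    have : x u - m ≠ 0 := sub_ne_zero.2 hu1
    positivity
  have hexp : ∀ m : ℝ, ∫ u in a..b, g u * (x u - m) ^ 2 * deriv x u ^ 4
      = A2 - 2 * m * A1 + m ^ 2 * A0 := fun m => by
    have i0 : IntervalIntegrable (fun u => m ^ 2 * (g u * deriv x u ^ 4)) volume a b :=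
      Continuous.intervalIntegrable (by fun_prop) _ _
    have i1 : IntervalIntegrable (fun u => 2 * m * (g u * x u * deriv x u ^ 4)) volume a b :=
      Continuous.intervalIntegrable (by fun_prop) _ _
    have i2 : IntervalIntegrable (fun u => g u * x u ^ 2 * deriv x u ^ 4) volume a b :=
      Continuous.intervalIntegrable (by fun_prop) _ _
    simp only [A0, A1, A2]
    rw [← intervalIntegral.integral_const_mul, ← intervalIntegral.integral_const_mul,
      ← intervalIntegral.integral_sub i2 i1, ← intervalIntegral.integral_add (i2.sub i1) i0]
    congr 1
    ext u
    ring
  have h := hm (A1 / A0)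
  rw [hexp] at h
  have h' := mul_pos hA0 h
  have e : A0 * (A2 - 2 * (A1 / A0) * A1 + (A1 / A0) ^ 2 * A0) = A0 * A2 - A1 ^ 2 := by
    field_simp
    ring
  rwa [e] at h'

end Moments

/-- A smooth immersed closed plane curve `(x, y)` of period one. -/
structure IsPlaneLoop (x y : ℝ → ℝ) : Prop where
  smooth_fst : ContDiff ℝ ∞ x
  smooth_snd : ContDiff ℝ ∞ y
  periodic_fst : Function.Periodic x 1
  periodic_snd : Function.Periodic y 1
  immersed : ∀ s, deriv x s = 0 → deriv y s ≠ 0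

theorem Function.Periodic.deriv_of_periodic {f : ℝ → ℝ} {c : ℝ} (hf : Function.Periodic f c) :
    Function.Periodic (deriv f) c := fun s => by
  rw [← deriv_comp_add_const, show (fun s => f (s + c)) = f from funext hf]

namespace IsPlaneLoop

variable {x y : ℝ → ℝ}

theorem exists_deriv_fst_ne_zero (h : IsPlaneLoop x y) : ∃ c ∈ Ioo (0 : ℝ) 1, deriv x c ≠ 0 := by
  obtain ⟨c, hc, hc'⟩ := exists_deriv_eq_zero zero_lt_one h.smooth_snd.continuous.continuousOn
    (by simpa using (h.periodic_snd 0).symm)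
  exact ⟨c, hc, fun h0 => h.immersed c h0 hc'⟩

theorem gramDet_pos (h : IsPlaneLoop x y) : 0 < gramDet x := by
  obtain ⟨c, hc, hc'⟩ := h.exists_deriv_fst_ne_zero
  simpa [gramDet, moment_corrector_eq] using
    gram_pos (g := fun _ => 1) h.smooth_fst continuous_const (fun _ => zero_le_one) hc
      one_pos hc'

theorem periodic_corrector (h : IsPlaneLoop x y) (j : ℕ) :
    Function.Periodic (corrector j x) 1 := fun s => by
  simp only [corrector, h.periodic_fst s, h.periodic_fst.deriv_of_periodic s]

theorem balanced (h : IsPlaneLoop x y) : IsPlaneLoop x (balance x y) where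
  smooth_fst := h.smooth_fst
  smooth_snd := contDiff_balance h.smooth_fst h.smooth_snd
  periodic_fst := h.periodic_fst
  periodic_snd s := by
    simp only [balance, h.periodic_snd s, h.periodic_corrector _ s]
  immersed s hs := by
    rw [deriv_balance_of_deriv_eq_zero h.smooth_fst h.smooth_snd hs]
    exact h.immersed s hs

theorem periodic_moment (h : IsPlaneLoop x y) (k : ℕ) (h0 : moment k x y 0 1 = 0) :
    Function.Periodic (fun s => moment k x y 0 s) 1 := fun s => by
  have hc := continuous_moment_integrand k h.smooth_fst h.smooth_snd.continuous
  have hp : Function.Periodic (fun u => y u * x u ^ k * deriv x u) 1 := fun u => by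
    simp only [h.periodic_fst u, h.periodic_snd u, h.periodic_fst.deriv_of_periodic u]
  have := hp.intervalIntegral_add_eq_add 0 s fun _ _ => hc.intervalIntegrable _ _
  rw [zero_add] at this
  change moment k x y 0 (s + 1) = moment k x y 0 s + moment k x y 0 1 at this
  simpa [h0] using this

end IsPlaneLoop

/-- The horizontal curve over `(x, balance x y)` whose last two coordinates start at `z₀`, `w₀`. -/
noncomputable def horizontalLift (x y : ℝ → ℝ) (z₀ w₀ : ℝ) (s : ℝ) : ℝ × ℝ × ℝ × ℝ :=
  (x s, balance x y s, z₀ + moment 0 x (balance x y) 0 s,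
    w₀ + (z₀ + moment 0 x (balance x y) 0 s) * x s - z₀ * x 0 - moment 1 x (balance x y) 0 s)

/-- The parameters `s`, `s + h` give the same point of the horizontal lift of `(x, y)`. -/
def IsDoublePoint (x y : ℝ → ℝ) (s h : ℝ) : Prop :=
  x (s + h) = x s ∧ balance x y (s + h) = balance x y s ∧
    moment 0 x (balance x y) s (s + h) = 0 ∧ moment 1 x (balance x y) s (s + h) = 0

theorem exists_shift_of_not_int {s₀ s₁ : ℝ} (h : ¬ ∃ k : ℤ, s₁ - s₀ = k) :
    ∃ s t : ℝ, ∃ m n : ℤ, s ∈ Icc (0 : ℝ) 1 ∧ t ∈ Ioc (0 : ℝ) (1 / 2) ∧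
      ((s + m = s₀ ∧ s + t + n = s₁) ∨ (s + m = s₁ ∧ s + t + n = s₀)) := by
  have hpos : 0 < Int.fract (s₁ - s₀) :=
    lt_of_le_of_ne (Int.fract_nonneg _) fun h0 => h ⟨⌊s₁ - s₀⌋, by
      have := Int.self_sub_floor (s₁ - s₀)
      linarith⟩
  have e := Int.self_sub_floor (s₁ - s₀)
  rcases le_or_gt (Int.fract (s₁ - s₀)) (1 / 2) with hle | hgt
  · refine ⟨Int.fract s₀, Int.fract (s₁ - s₀), ⌊s₀⌋, ⌊s₀⌋ + ⌊s₁ - s₀⌋,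
      ⟨Int.fract_nonneg _, (Int.fract_lt_one _).le⟩, ⟨hpos, hle⟩, Or.inl ⟨?_, ?_⟩⟩
    · exact Int.fract_add_floor s₀
    · have := Int.self_sub_floor s₀
      push_cast
      linarith
  · refine ⟨Int.fract s₁, 1 - Int.fract (s₁ - s₀), ⌊s₁⌋, ⌊s₁⌋ - ⌊s₁ - s₀⌋ - 1,
      ⟨Int.fract_nonneg _, (Int.fract_lt_one _).le⟩,
      ⟨by linarith [Int.fract_lt_one (s₁ - s₀)], by linarith⟩, Or.inr ⟨?_, ?_⟩⟩
    · exact Int.fract_add_floor s₁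
    · have := Int.self_sub_floor s₁
      push_cast
      linarith

theorem IsPlaneLoop.isHorizontalLoop_lift {x y : ℝ → ℝ} (h : IsPlaneLoop x y) (z₀ w₀ : ℝ)
    (hd : ∀ s ∈ Icc (0 : ℝ) 1, ∀ t ∈ Ioc (0 : ℝ) (1 / 2), ¬ IsDoublePoint x y s t) :
    IsHorizontalLoop (horizontalLift x y z₀ w₀) := by
  have hx := h.smooth_fst
  have hb := h.balanced
  have hB := hb.smooth_snd
  have hm : ∀ k s, HasDerivAt (fun s => moment k x (balance x y) 0 s)
      (balance x y s * x s ^ k * deriv x s) s := fun k s => hasDerivAt_moment k hx hB.continuous 0 s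
  have hms : ∀ k, ContDiff ℝ ∞ fun s => moment k x (balance x y) 0 s := fun k =>
    contDiff_infty_iff_deriv.2 ⟨fun s => (hm k s).differentiableAt, by
      rw [show deriv (fun s => moment k x (balance x y) 0 s) = _ from
        funext fun s => (hm k s).deriv]
      exact (hB.mul (hx.pow k)).mul (contDiff_deriv hx)⟩
  have hD := h.gramDet_pos.ne'
  have hp0 := hb.periodic_moment 0 (moment_zero_balance hx h.smooth_snd.continuous hD)
  have hp1 := hb.periodic_moment 1 (moment_one_balance hx h.smooth_snd.continuous hD)
  have hsm : ContDiff ℝ ∞ (horizontalLift x y z₀ w₀) := by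
    refine hx.prodMk (hB.prodMk ((contDiff_const.add (hms 0)).prodMk ?_))
    exact ((contDiff_const.add ((contDiff_const.add (hms 0)).mul hx)).sub contDiff_const).sub
      (hms 1)
  have hper : Function.Periodic (horizontalLift x y z₀ w₀) 1 := fun s => by
    have e0 := hp0 s
    have e1 := hp1 s
    simp only at e0 e1
    simp only [horizontalLift, e0, e1, hb.periodic_fst s, hb.periodic_snd s]
  have hx1 : ∀ s, HasDerivAt x (deriv x s) s :=
    fun s => (hx.differentiable (by simp) s).hasDerivAt
  refine ⟨hsm, hper, fun s h0 => ?_, fun s => ?_, fun s => ?_, fun s₀ s₁ he => ?_⟩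
  · have hd := (hsm.differentiable (by simp) s).hasDerivAt
    rw [h0] at hd
    have h1 : HasDerivAt x 0 s := hd.fst
    have h2 : HasDerivAt (balance x y) 0 s := hd.snd.fst
    exact hb.immersed s h1.deriv h2.deriv
  · change deriv (fun t => z₀ + moment 0 x (balance x y) 0 t) s = balance x y s * deriv x s
    simpa using ((hm 0 s).const_add z₀).deriv
  · have := (((((hm 0 s).const_add z₀).mul (hx1 s)).const_add w₀).sub_const (z₀ * x 0)).sub (hm 1 s)
    refine Eq.trans this.deriv ?_
    simp only [horizontalLift]
    ring
  · by_contra hcon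
    obtain ⟨s, t, m, n, hs, ht, hcase⟩ := exists_shift_of_not_int hcon
    have hshift : ∀ (k : ℤ) (u : ℝ), horizontalLift x y z₀ w₀ (u + k)
        = horizontalLift x y z₀ w₀ u := fun k u => by
      simpa using (hper.int_mul k) u
    have hst : horizontalLift x y z₀ w₀ s = horizontalLift x y z₀ w₀ (s + t) := by
      rw [← hshift m s, ← hshift n (s + t)]
      rcases hcase with ⟨h1, h2⟩ | ⟨h1, h2⟩
      · rw [h1, h2, he]
      · rw [h1, h2, he]
    simp only [horizontalLift, Prod.mk.injEq] at hst
    obtain ⟨e1, e2, e3, e4⟩ := hst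
    refine hd s hs t ht ⟨e1.symm, e2.symm, ?_, ?_⟩
    · rw [← moment_sub 0 hx hB.continuous 0]
      linarith
    · rw [← moment_sub 1 hx hB.continuous 0]
      rw [← e3, e1] at e4
      linarith

namespace IsHorizontalLoop

variable {γ : ℝ → ℝ × ℝ × ℝ × ℝ}

theorem isPlaneLoop (h : IsHorizontalLoop γ) :
    IsPlaneLoop (fun s => (γ s).1) (fun s => (γ s).2.1) where
  smooth_fst := contDiff_fst.comp h.smooth
  smooth_snd := contDiff_fst.comp (contDiff_snd.comp h.smooth)
  periodic_fst s := by simp only [h.periodic s]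
  periodic_snd s := by simp only [h.periodic s]
  immersed s h1 h2 := by
    have hd := (h.smooth.differentiable (by simp) s).hasDerivAt
    refine h.immersed s ?_
    have e1 : HasDerivAt (fun s => (γ s).1) (deriv γ s).1 s := hd.fst
    have e2 : HasDerivAt (fun s => (γ s).2.1) (deriv γ s).2.1 s := hd.snd.fst
    have e3 : HasDerivAt (fun s => (γ s).2.2.1) (deriv γ s).2.2.1 s := hd.snd.snd.fst
    have e4 : HasDerivAt (fun s => (γ s).2.2.2) (deriv γ s).2.2.2 s := hd.snd.snd.snd
    have t3 := h.tangent_z s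
    have t4 := h.tangent_w s
    rw [h1, mul_zero] at t3 t4
    ext
    · exact e1.deriv.symm.trans h1
    · exact e2.deriv.symm.trans h2
    · exact e3.deriv.symm.trans t3
    · exact e4.deriv.symm.trans t4

theorem moments (h : IsHorizontalLoop γ) (s : ℝ) :
    moment 0 (fun s => (γ s).1) (fun s => (γ s).2.1) 0 s = (γ s).2.2.1 - (γ 0).2.2.1 ∧
    moment 1 (fun s => (γ s).1) (fun s => (γ s).2.1) 0 s
      = (γ s).2.2.1 * (γ s).1 - (γ s).2.2.2 - ((γ 0).2.2.1 * (γ 0).1 - (γ 0).2.2.2) := by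
  have hp := h.isPlaneLoop
  have hz : ∀ u, HasDerivAt (fun t => (γ t).2.2.1) ((γ u).2.1 * deriv (fun t => (γ t).1) u) u :=
    fun u => by
      rw [← h.tangent_z u]
      exact ((contDiff_fst.comp (contDiff_snd.comp (contDiff_snd.comp h.smooth))).differentiable
        (by simp) u).hasDerivAt
  have hw : ∀ u, HasDerivAt (fun t => (γ t).2.2.2) ((γ u).2.2.1 * deriv (fun t => (γ t).1) u) u :=
    fun u => by
      rw [← h.tangent_w u]
      exact ((contDiff_snd.comp (contDiff_snd.comp (contDiff_snd.comp h.smooth))).differentiable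
        (by simp) u).hasDerivAt
  have hx : ∀ u, HasDerivAt (fun t => (γ t).1) (deriv (fun t => (γ t).1) u) u := fun u =>
    (hp.smooth_fst.differentiable (by simp) u).hasDerivAt
  constructor
  · refine integral_eq_sub_of_hasDerivAt (f := fun t => (γ t).2.2.1) (fun u _ => ?_)
      ((continuous_moment_integrand 0 hp.smooth_fst hp.smooth_snd.continuous).intervalIntegrable ..)
    simpa using hz u
  · refine integral_eq_sub_of_hasDerivAt (f := fun t => (γ t).2.2.1 * (γ t).1 - (γ t).2.2.2)
      (fun u _ => ?_)
      ((continuous_moment_integrand 1 hp.smooth_fst hp.smooth_snd.continuous).intervalIntegrable ..)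
    convert! ((hz u).mul (hx u)).sub (hw u) using 1
    ring

theorem lift_eq (h : IsHorizontalLoop γ) :
    horizontalLift (fun s => (γ s).1) (fun s => (γ s).2.1) (γ 0).2.2.1 (γ 0).2.2.2 = γ := by
  have hγ : γ 1 = γ 0 := by simpa using h.periodic 0
  have hb : balance (fun s => (γ s).1) (fun s => (γ s).2.1) = fun s => (γ s).2.1 :=
    balance_eq_self (by rw [(h.moments 1).1, hγ, sub_self])
      (by rw [(h.moments 1).2, hγ, sub_self])
  funext s
  simp only [horizontalLift, hb, (h.moments s).1, (h.moments s).2]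
  ext <;> simp
  ring

end IsHorizontalLoop

/-- `θ` is a continuous choice of polar angle for the nowhere vanishing curve `(a, b)`. -/
def IsAngle (a b θ : ℝ → ℝ) : Prop :=
  Continuous θ ∧ ∀ s, ∃ r > 0, a s = r * Real.cos (θ s) ∧ b s = r * Real.sin (θ s)

theorem exists_int_of_cos_sin_eq {θ φ : ℝ → ℝ} (hθ : Continuous θ) (hφ : Continuous φ)
    (hc : ∀ s, Real.cos (θ s) = Real.cos (φ s)) (hs : ∀ s, Real.sin (θ s) = Real.sin (φ s)) :
    ∃ k : ℤ, ∀ s, θ s = φ s + 2 * Real.pi * k := by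
  have h : ∀ s, ∃ k : ℤ, θ s - φ s = 2 * Real.pi * k := fun s =>
    Real.Angle.angle_eq_iff_two_pi_dvd_sub.1 (Real.Angle.cos_sin_inj (hc s) (hs s))
  choose f hf using h
  have hfc : Continuous f := by
    rw [Int.isClosedEmbedding_coe_real.isInducing.continuous_iff]
    have : ((↑) : ℤ → ℝ) ∘ f = fun s => (θ s - φ s) / (2 * Real.pi) := by
      funext s
      rw [hf s]
      field_simp
      rfl
    rw [this]
    fun_prop
  refine ⟨f 0, fun s => ?_⟩
  have := hf s
  rw [PreconnectedSpace.constant inferInstance hfc (x := s) (y := 0)] at this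
  linarith

namespace IsAngle

variable {a b θ φ : ℝ → ℝ}

theorem cos_sin_eq {r r' α β : ℝ} (hr : 0 < r) (hr' : 0 < r')
    (hc : r * Real.cos α = r' * Real.cos β) (hs : r * Real.sin α = r' * Real.sin β) :
    Real.cos α = Real.cos β ∧ Real.sin α = Real.sin β := by
  have h : r ^ 2 = r' ^ 2 := by
    nlinarith [Real.cos_sq_add_sin_sq α, Real.cos_sq_add_sin_sq β, congrArg (· ^ 2) hc,
      congrArg (· ^ 2) hs]
  have h' : r = r' := (sq_eq_sq₀ hr.le hr'.le).1 h
  subst h'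
  exact ⟨mul_left_cancel₀ hr.ne' hc, mul_left_cancel₀ hr.ne' hs⟩

theorem exists_int (h : IsAngle a b θ) (h' : IsAngle a b φ) :
    ∃ k : ℤ, ∀ s, θ s = φ s + 2 * Real.pi * k := by
  have hcs : ∀ s, Real.cos (θ s) = Real.cos (φ s) ∧ Real.sin (θ s) = Real.sin (φ s) := fun s => by
    obtain ⟨r, hr, e1, e2⟩ := h.2 s
    obtain ⟨r', hr', e1', e2'⟩ := h'.2 s
    exact cos_sin_eq hr hr' (e1.symm.trans e1') (e2.symm.trans e2')
  exact exists_int_of_cos_sin_eq h.1 h'.1 (fun s => (hcs s).1) fun s => (hcs s).2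

theorem add_arctan (h : IsAngle a b θ) {a' b' : ℝ → ℝ} (ha : Continuous a) (hb : Continuous b)
    (ha' : Continuous a') (hb' : Continuous b') (hpos : ∀ s, 0 < a s * a' s + b s * b' s) :
    IsAngle a' b' fun s =>
      θ s + Real.arctan ((a s * b' s - b s * a' s) / (a s * a' s + b s * b' s)) := by
  refine ⟨h.1.add (Real.continuous_arctan.comp (Continuous.div (by fun_prop) (by fun_prop)
    fun s => (hpos s).ne')), fun s => ?_⟩
  obtain ⟨r, hr, e1, e2⟩ := h.2 s
  have hP := hpos s
  set P := a s * a' s + b s * b' s with hPd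
  set Q := a s * b' s - b s * a' s with hQd
  have hS : 0 < Real.sqrt (1 + (Q / P) ^ 2) := Real.sqrt_pos.2 (by positivity)
  have hcs := Real.cos_sq_add_sin_sq (θ s)
  have hq : P * (Q / P) = Q := by field_simp
  refine ⟨P * Real.sqrt (1 + (Q / P) ^ 2) / r, by positivity, ?_, ?_⟩
  · rw [Real.cos_add, Real.cos_arctan, Real.sin_arctan]
    generalize Real.sqrt (1 + (Q / P) ^ 2) = σ at *
    generalize Q / P = q at *
    field_simp
    rw [mul_sub, mul_left_comm, hq, hPd, hQd, e1, e2]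
    linear_combination (-a' s * r) * hcs
  · rw [Real.sin_add, Real.cos_arctan, Real.sin_arctan]
    generalize Real.sqrt (1 + (Q / P) ^ 2) = σ at *
    generalize Q / P = q at *
    field_simp
    rw [mul_add, mul_left_comm P _ q, hq, hPd, hQd, e1, e2]
    linear_combination (-b' s * r) * hcs

end IsAngle

theorem isAngle_of_polar {a b θ : ℝ → ℝ} (hθ : Continuous θ) (hab : ∀ s, a s = 0 → b s ≠ 0)
    (h : ∀ s, a s = Real.sqrt (a s ^ 2 + b s ^ 2) * Real.cos (θ s) ∧
      b s = Real.sqrt (a s ^ 2 + b s ^ 2) * Real.sin (θ s)) : IsAngle a b θ := by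
  refine ⟨hθ, fun s => ⟨_, Real.sqrt_pos.2 ?_, h s⟩⟩
  rcases eq_or_ne (a s) 0 with h0 | h0
  · have := hab s h0
    positivity
  · positivity

/-- The angle of the velocity of a horizontal loop with rotation number `n`. -/
theorem HasRotationNumber.exists_isAngle {γ : ℝ → ℝ × ℝ × ℝ × ℝ} {n : ℤ}
    (hr : HasRotationNumber γ n) (h : IsHorizontalLoop γ) :
    ∃ θ, IsAngle (deriv fun s => (γ s).1) (deriv fun s => (γ s).2.1) θ ∧
      θ 1 - θ 0 = 2 * Real.pi * n := by
  obtain ⟨θ, hθ, hp, h1⟩ := hr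
  exact ⟨θ, isAngle_of_polar hθ h.isPlaneLoop.immersed hp, h1⟩

theorem Function.Periodic.map_fract {f : ℝ → ℝ} (hf : Function.Periodic f 1) (s : ℝ) :
    f (Int.fract s) = f s := by
  rw [Int.fract, ← mul_one (⌊s⌋ : ℝ)]
  exact hf.sub_int_mul_eq ⌊s⌋

theorem eventually_inner_pos {a b : ℝ → ℝ → ℝ} {S : Set ℝ}
    (ha : ContinuousOn (Function.uncurry a) (S ×ˢ univ))
    (hb : ContinuousOn (Function.uncurry b) (S ×ˢ univ))
    (hper : ∀ t ∈ S, Function.Periodic (a t) 1 ∧ Function.Periodic (b t) 1)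
    (hne : ∀ t ∈ S, ∀ s, a t s = 0 → b t s ≠ 0) {t₀ : ℝ} (ht₀ : t₀ ∈ S) :
    ∀ᶠ t in 𝓝[S] t₀, ∀ s, 0 < a t₀ s * a t s + b t₀ s * b t s := by
  have key : ∀ᶠ t in 𝓝[S] t₀, ∀ s ∈ Icc (0 : ℝ) 1, 0 < a t₀ s * a t s + b t₀ s * b t s := by
    have hcont : ContinuousOn (fun p : ℝ × ℝ => a t₀ p.2 * a p.1 p.2 + b t₀ p.2 * b p.1 p.2)
        (S ×ˢ univ) := by
      have hm : MapsTo (fun p : ℝ × ℝ => (t₀, p.2)) (S ×ˢ univ) (S ×ˢ univ) :=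
        fun p _ => ⟨ht₀, mem_univ _⟩
      have hc : ContinuousOn (fun p : ℝ × ℝ => (t₀, p.2)) (S ×ˢ univ) := by fun_prop
      exact ((ha.comp hc hm).mul ha).add ((hb.comp hc hm).mul hb)
    have h1 : ∀ s ∈ Icc (0 : ℝ) 1, ∀ᶠ z : ℝ × ℝ in 𝓝 (t₀, s),
        z.1 ∈ S → 0 < a t₀ z.2 * a z.1 z.2 + b t₀ z.2 * b z.1 z.2 := fun s _ => by
      have hp : 0 < a t₀ s * a t₀ s + b t₀ s * b t₀ s := by
        rcases eq_or_ne (a t₀ s) 0 with h0 | h0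
        · have := mul_self_pos.2 (hne t₀ ht₀ s h0)
          nlinarith [mul_self_nonneg (a t₀ s)]
        · have := mul_self_pos.2 h0
          nlinarith [mul_self_nonneg (b t₀ s)]
      have h2 := (hcont (t₀, s) ⟨ht₀, mem_univ _⟩).eventually (lt_mem_nhds hp)
      rw [eventually_nhdsWithin_iff] at h2
      exact h2.mono fun z hz hzS => hz ⟨hzS, mem_univ _⟩
    rw [eventually_nhdsWithin_iff]
    filter_upwards [isCompact_Icc.eventually_forall_of_forall_eventually
      (P := fun t s => t ∈ S → 0 < a t₀ s * a t s + b t₀ s * b t s) h1] with t ht htS s hs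
    exact ht s hs htS
  filter_upwards [key, self_mem_nhdsWithin] with t ht htS s
  have h1 := ht (Int.fract s) ⟨Int.fract_nonneg _, (Int.fract_lt_one _).le⟩
  rwa [(hper _ ht₀).1.map_fract, (hper _ ht₀).2.map_fract, (hper _ htS).1.map_fract,
    (hper _ htS).2.map_fract] at h1

/-- The velocities of a horizontal isotopy depend continuously on time and position. -/
theorem IsHorizontalIsotopy.continuousOn_deriv {H : ℝ → ℝ → ℝ × ℝ × ℝ × ℝ}
    (hH : IsHorizontalIsotopy H) :
    ContinuousOn (fun p : ℝ × ℝ => deriv (H p.1) p.2) (Icc (0 : ℝ) 1 ×ˢ univ) := by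
  have hu : UniqueDiffOn ℝ (Icc (0 : ℝ) 1 ×ˢ (univ : Set ℝ)) :=
    (uniqueDiffOn_Icc zero_lt_one).prod uniqueDiffOn_univ
  have hc := (hH.1.continuousOn_fderivWithin hu (by simp)).clm_apply
    (continuousOn_const (c := ((0 : ℝ), (1 : ℝ))))
  refine hc.congr fun p hp => ?_
  have h1 := ((hH.1.differentiableOn (by simp)) p hp).hasFDerivWithinAt
  have h2 : HasDerivAt (fun u : ℝ => (p.1, u)) ((0 : ℝ), (1 : ℝ)) p.2 :=
    (hasDerivAt_const _ _).prodMk (hasDerivAt_id _)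
  have h3 := h1.comp_hasDerivAt_of_eq p.2 h2 (Eventually.of_forall fun u => ⟨hp.1, mem_univ _⟩) rfl
  exact h3.deriv

theorem IsHorizontalIsotopy.rot_eq {H : ℝ → ℝ → ℝ × ℝ × ℝ × ℝ} (hH : IsHorizontalIsotopy H)
    {n₀ n₁ : ℤ} (h₀ : HasRotationNumber (H 0) n₀) (h₁ : HasRotationNumber (H 1) n₁) : n₀ = n₁ := by
  set a : ℝ → ℝ → ℝ := fun t => deriv fun s => (H t s).1 with ha_def
  set b : ℝ → ℝ → ℝ := fun t => deriv fun s => (H t s).2.1 with hb_def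
  have h01 : (0 : ℝ) ∈ Icc (0 : ℝ) 1 := ⟨le_rfl, zero_le_one⟩
  have h11 : (1 : ℝ) ∈ Icc (0 : ℝ) 1 := ⟨zero_le_one, le_rfl⟩
  have hloop := fun t ht => (hH.2 t ht).isPlaneLoop
  have hcd := hH.continuousOn_deriv
  have ha : ContinuousOn (Function.uncurry a) (Icc (0 : ℝ) 1 ×ˢ univ) := by
    refine hcd.fst.congr fun p hp => ?_
    have h := ((hH.2 p.1 hp.1).smooth.differentiable (by simp) p.2).hasDerivAt
    have h' : HasDerivAt (fun s => (H p.1 s).1) (deriv (H p.1) p.2).1 p.2 := h.fst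
    exact h'.deriv
  have hb : ContinuousOn (Function.uncurry b) (Icc (0 : ℝ) 1 ×ˢ univ) := by
    refine hcd.snd.fst.congr fun p hp => ?_
    have h := ((hH.2 p.1 hp.1).smooth.differentiable (by simp) p.2).hasDerivAt
    have h' : HasDerivAt (fun s => (H p.1 s).2.1) (deriv (H p.1) p.2).2.1 p.2 := h.snd.fst
    exact h'.deriv
  have hper : ∀ t ∈ Icc (0 : ℝ) 1, Function.Periodic (a t) 1 ∧ Function.Periodic (b t) 1 :=
    fun t ht => ⟨(hloop t ht).periodic_fst.deriv_of_periodic,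
      (hloop t ht).periodic_snd.deriv_of_periodic⟩
  have hac : ∀ t ∈ Icc (0 : ℝ) 1, Continuous (a t) ∧ Continuous (b t) := fun t ht =>
    ⟨(contDiff_deriv (hloop t ht).smooth_fst).continuous,
      (contDiff_deriv (hloop t ht).smooth_snd).continuous⟩
  let P : ℝ → ℝ → Prop := fun t t' => t ∈ Icc (0 : ℝ) 1 → t' ∈ Icc (0 : ℝ) 1 → ∀ θ,
    IsAngle (a t) (b t) θ → ∃ θ', IsAngle (a t') (b t') θ' ∧ θ' 1 - θ' 0 = θ 1 - θ 0
  have step : ∀ t t', (∀ s, 0 < a t s * a t' s + b t s * b t' s) → P t t' := by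
    intro t t' hpos ht ht' θ hθ
    refine ⟨_, hθ.add_arctan (hac t ht).1 (hac t ht).2 (hac t' ht').1 (hac t' ht').2 hpos, ?_⟩
    have e : ∀ {f : ℝ → ℝ}, Function.Periodic f 1 → f 1 = f 0 := fun hf => by simpa using hf 0
    simp only [e (hper t ht).1, e (hper t ht).2, e (hper t' ht').1, e (hper t' ht').2]
    ring
  have hP : P 0 1 := by
    have : ∀ t ∈ Icc (0 : ℝ) 1, ∀ t' ∈ Icc (0 : ℝ) 1, P t t' := fun t ht t' ht' => by
      refine isPreconnected_Icc.induction₂' P (fun u hu => ?_) ?_ ht ht'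
      · filter_upwards [eventually_inner_pos ha hb hper (fun t ht => (hloop t ht).immersed) hu]
          with v hv
        exact ⟨step u v hv, step v u fun s => by have := hv s; linarith⟩
      · intro t u v ht hu hv h1 h2 _ _ θ hθ
        obtain ⟨θ', hθ', e'⟩ := h1 ht hu θ hθ
        obtain ⟨θ'', hθ'', e''⟩ := h2 hu hv θ' hθ'
        exact ⟨θ'', hθ'', e''.trans e'⟩
    exact this 0 h01 1 h11
  obtain ⟨θ₀, hθ₀, e₀⟩ := h₀.exists_isAngle (hH.2 0 h01)
  obtain ⟨θ₁, hθ₁, e₁⟩ := h₁.exists_isAngle (hH.2 1 h11)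
  obtain ⟨θ, hθ, e⟩ := hP h01 h11 θ₀ hθ₀
  obtain ⟨k, hk⟩ := hθ.exists_int hθ₁
  have h : 2 * Real.pi * (n₀ : ℝ) = 2 * Real.pi * n₁ := by
    rw [← e₀, ← e₁, ← e, hk 1, hk 0]
    ring
  have := mul_left_cancel₀ (by positivity) h
  exact_mod_cast this

section Joined

variable {F : Type} [NormedAddCommGroup F] [NormedSpace ℝ F] {P : (ℝ → F) → Prop}
  {f g k : ℝ → F}

/-- The curves `f` and `g` are joined by a smooth family of curves satisfying `P`, constant near
the ends. -/
def SmoothlyJoined (P : (ℝ → F) → Prop) (f g : ℝ → F) : Prop :=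
  ∃ H : ℝ → ℝ → F, ContDiff ℝ ∞ (Function.uncurry H) ∧ (∀ t, P (H t)) ∧
    (∀ t ≤ 0, H t = f) ∧ ∀ t ≥ 1, H t = g

theorem SmoothlyJoined.of_segment {K : ℝ → ℝ → F} (hK : ContDiff ℝ ∞ (Function.uncurry K))
    (hP : ∀ t ∈ Icc (0 : ℝ) 1, P (K t)) : SmoothlyJoined P (K 0) (K 1) := by
  refine ⟨fun t => K (Real.smoothTransition t), ?_, fun t => hP _
    ⟨Real.smoothTransition.nonneg t, Real.smoothTransition.le_one t⟩, fun t ht => ?_,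
    fun t ht => ?_⟩
  · exact hK.comp ((Real.smoothTransition.contDiff.comp contDiff_fst).prodMk contDiff_snd)
  · simp only [Real.smoothTransition.zero_of_nonpos ht]
  · simp only [Real.smoothTransition.one_of_one_le ht]

theorem SmoothlyJoined.symm (h : SmoothlyJoined P f g) : SmoothlyJoined P g f := by
  obtain ⟨H, hs, hP, h0, h1⟩ := h
  refine ⟨fun t => H (1 - t), ?_, fun t => hP _, fun t ht => h1 _ (by linarith),
    fun t ht => h0 _ (by linarith)⟩
  exact hs.comp ((contDiff_const.sub contDiff_fst).prodMk contDiff_snd)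

theorem SmoothlyJoined.trans (h : SmoothlyJoined P f g) (h' : SmoothlyJoined P g k) :
    SmoothlyJoined P f k := by
  obtain ⟨H, hs, hP, h0, h1⟩ := h
  obtain ⟨H', hs', hP', h0', h1'⟩ := h'
  let K : ℝ → ℝ → F := fun t => if t < 3 / 2 then H t else H' (t - 2)
  have e1 : ∀ t < 2, K t = H t := fun t ht => by
    by_cases h : t < 3 / 2
    · simp [K, h]
    · simp only [K, h, if_false]
      rw [h0' _ (by linarith), h1 _ (by linarith)]
  have e2 : ∀ t > 1, K t = H' (t - 2) := fun t ht => by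
    by_cases h : t < 3 / 2
    · simp only [K, h, if_true]
      rw [h0' _ (by linarith), h1 _ (by linarith)]
    · simp [K, h]
  have hK : ContDiff ℝ ∞ (Function.uncurry K) := by
    rw [contDiff_iff_contDiffAt]
    rintro ⟨t, s⟩
    rcases lt_or_ge t 2 with ht | ht
    · refine hs.contDiffAt.congr_of_eventuallyEq ?_
      filter_upwards [continuousAt_fst.eventually (gt_mem_nhds (show (t, s).1 < 2 from ht))]
        with p hp
      exact congrFun (e1 _ hp) _
    · have : ContDiff ℝ ∞ fun p : ℝ × ℝ => Function.uncurry H' (p.1 - 2, p.2) :=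
        hs'.comp ((contDiff_fst.sub contDiff_const).prodMk contDiff_snd)
      refine this.contDiffAt.congr_of_eventuallyEq ?_
      filter_upwards [continuousAt_fst.eventually
        (lt_mem_nhds (show 1 < (t, s).1 by simp only; linarith))] with p hp
      exact congrFun (e2 _ hp) _
  refine ⟨fun t => K (3 * t), ?_, fun t => ?_, fun t ht => ?_, fun t ht => ?_⟩
  · exact hK.comp ((contDiff_const.mul contDiff_fst).prodMk contDiff_snd)
  · simp only [K]
    split_ifs
    exacts [hP _, hP' _]
  · change K (3 * t) = f
    rw [e1 _ (by linarith), h0 _ (by linarith)]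
  · change K (3 * t) = k
    rw [e2 _ (by linarith), h1' _ (by linarith)]

end Joined

section Angle

variable {x y θ : ℝ → ℝ}

/-- The polar angle of a smooth nowhere vanishing curve is smooth. -/
theorem IsAngle.contDiff {a b : ℝ → ℝ} (h : IsAngle a b θ) (ha : ContDiff ℝ ∞ a)
    (hb : ContDiff ℝ ∞ b) : ContDiff ℝ ∞ θ := by
  have hpos : ∀ s, 0 < a s ^ 2 + b s ^ 2 := fun s => by
    obtain ⟨r, hr, e1, e2⟩ := h.2 s
    have : a s ^ 2 + b s ^ 2 = r ^ 2 := by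
      rw [e1, e2]
      linear_combination r ^ 2 * Real.cos_sq_add_sin_sq (θ s)
    rw [this]
    positivity
  have hρ : ContDiff ℝ ∞ fun s => Real.sqrt (a s ^ 2 + b s ^ 2) :=
    ((ha.pow 2).add (hb.pow 2)).sqrt fun s => (hpos s).ne'
  have hρ0 : ∀ s, Real.sqrt (a s ^ 2 + b s ^ 2) ≠ 0 := fun s => (Real.sqrt_pos.2 (hpos s)).ne'
  have hr : ∀ s, ∀ r > 0, a s = r * Real.cos (θ s) → b s = r * Real.sin (θ s) →
      Real.sqrt (a s ^ 2 + b s ^ 2) = r := fun s r hr e1 e2 => by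
    rw [show a s ^ 2 + b s ^ 2 = r ^ 2 by
      rw [e1, e2]
      linear_combination r ^ 2 * Real.cos_sq_add_sin_sq (θ s), Real.sqrt_sq hr.le]
  set c : ℝ → ℝ := fun s => a s / Real.sqrt (a s ^ 2 + b s ^ 2)
  set σ : ℝ → ℝ := fun s => b s / Real.sqrt (a s ^ 2 + b s ^ 2)
  have hcθ : ∀ s, c s = Real.cos (θ s) := fun s => by
    obtain ⟨r, hr0, e1, e2⟩ := h.2 s
    simp only [c, hr s r hr0 e1 e2]
    rw [e1]
    field_simp
  have hσθ : ∀ s, σ s = Real.sin (θ s) := fun s => by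
    obtain ⟨r, hr0, e1, e2⟩ := h.2 s
    simp only [σ, hr s r hr0 e1 e2]
    rw [e2]
    field_simp
  have hc : ContDiff ℝ ∞ c := ha.div hρ hρ0
  have hσ : ContDiff ℝ ∞ σ := hb.div hρ hρ0
  set κ : ℝ → ℝ := fun s => c s * deriv σ s - σ s * deriv c s
  have hκ : ContDiff ℝ ∞ κ :=
    (hc.mul (contDiff_deriv hσ)).sub (hσ.mul (contDiff_deriv hc))
  have hone : ∀ s, c s ^ 2 + σ s ^ 2 = 1 := fun s => by
    rw [hcθ, hσθ]
    exact Real.cos_sq_add_sin_sq _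
  have dc : ∀ s, HasDerivAt c (deriv c s) s := fun s =>
    (hc.differentiable (by simp) s).hasDerivAt
  have dσ : ∀ s, HasDerivAt σ (deriv σ s) s := fun s =>
    (hσ.differentiable (by simp) s).hasDerivAt
  have horth : ∀ s, c s * deriv c s + σ s * deriv σ s = 0 := fun s => by
    have h1 : HasDerivAt (fun s => c s ^ 2 + σ s ^ 2)
        (2 * c s * deriv c s + 2 * σ s * deriv σ s) s := by
      convert! ((dc s).fun_pow 2).add ((dσ s).fun_pow 2) using 1
      simp
    rw [show (fun s => c s ^ 2 + σ s ^ 2) = fun _ => 1 from funext hone] at h1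
    have := h1.unique (hasDerivAt_const s (1 : ℝ))
    linarith
  have ec : ∀ s, deriv c s = -σ s * κ s := fun s => by
    simp only [κ]
    linear_combination (-deriv c s) * hone s + c s * horth s
  have eσ : ∀ s, deriv σ s = c s * κ s := fun s => by
    simp only [κ]
    linear_combination (-deriv σ s) * hone s + σ s * horth s
  set φ : ℝ → ℝ := fun s => θ 0 + ∫ u in 0..s, κ u
  have dφ : ∀ s, HasDerivAt φ (κ s) s := fun s =>
    ((hκ.continuous.integral_hasStrictDerivAt 0 s).hasDerivAt).const_add _
  have hφ : ContDiff ℝ ∞ φ := contDiff_infty_iff_deriv.2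
    ⟨fun s => (dφ s).differentiableAt, by rwa [show deriv φ = κ from funext fun s => (dφ s).deriv]⟩
  have hu : ∀ s, c s * Real.cos (φ s) + σ s * Real.sin (φ s) = 1 := fun s => by
    have hd : ∀ s, HasDerivAt (fun s => c s * Real.cos (φ s) + σ s * Real.sin (φ s)) 0 s :=
      fun s => by
        convert! ((dc s).mul (dφ s).cos).add ((dσ s).mul (dφ s).sin) using 1
        rw [ec, eσ]
        ring
    rw [is_const_of_deriv_eq_zero (fun s => (hd s).differentiableAt) (fun s => (hd s).deriv) s 0]
    simp only [φ, hcθ, hσθ, integral_same, add_zero]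
    linear_combination Real.cos_sq_add_sin_sq (θ 0)
  have hv : ∀ s, σ s * Real.cos (φ s) - c s * Real.sin (φ s) = 0 := fun s => by
    have hd : ∀ s, HasDerivAt (fun s => σ s * Real.cos (φ s) - c s * Real.sin (φ s)) 0 s :=
      fun s => by
        convert! ((dσ s).mul (dφ s).cos).sub ((dc s).mul (dφ s).sin) using 1
        rw [ec, eσ]
        ring
    rw [is_const_of_deriv_eq_zero (fun s => (hd s).differentiableAt) (fun s => (hd s).deriv) s 0]
    simp only [φ, hcθ, hσθ, integral_same, add_zero]
    ring
  have hcφ : ∀ s, Real.cos (θ s) = Real.cos (φ s) := fun s => by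
    rw [← hcθ]
    linear_combination (-c s) * Real.cos_sq_add_sin_sq (φ s) + Real.cos (φ s) * hu s
      - Real.sin (φ s) * hv s
  have hsφ : ∀ s, Real.sin (θ s) = Real.sin (φ s) := fun s => by
    rw [← hσθ]
    linear_combination (-σ s) * Real.cos_sq_add_sin_sq (φ s) + Real.sin (φ s) * hu s
      + Real.cos (φ s) * hv s
  obtain ⟨k, hk⟩ := exists_int_of_cos_sin_eq h.1 hφ.continuous hcφ hsφ
  rw [show θ = fun s => φ s + 2 * Real.pi * k from funext hk]
  exact hφ.add contDiff_const

theorem IsAngle.map_add_one {a b : ℝ → ℝ} (h : IsAngle a b θ) (ha : Function.Periodic a 1)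
    (hb : Function.Periodic b 1) (s : ℝ) : θ (s + 1) = θ s + (θ 1 - θ 0) := by
  have h' : IsAngle a b fun s => θ (s + 1) :=
    ⟨h.1.comp (continuous_id.add continuous_const), fun s => by
      obtain ⟨r, hr, e1, e2⟩ := h.2 (s + 1)
      exact ⟨r, hr, (ha s).symm.trans e1, (hb s).symm.trans e2⟩⟩
  obtain ⟨k, hk⟩ := h'.exists_int h
  have h0 := hk 0
  rw [zero_add] at h0
  rw [hk s, h0]
  ring

end Angle

section Winding

variable {θ : ℝ → ℝ} {n : ℤ}

/-- A smooth angle function of degree `n` whose cosine takes both signs. -/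
structure IsWindingAngle (n : ℤ) (θ : ℝ → ℝ) : Prop where
  smooth : ContDiff ℝ ∞ θ
  map_add_one : ∀ s, θ (s + 1) = θ s + 2 * Real.pi * n
  exists_pos : ∃ s, 0 < Real.cos (θ s)
  exists_neg : ∃ s, Real.cos (θ s) < 0

theorem cos_signs_of_crossing (hθ : Continuous θ) {L a b : ℝ} (hL : Real.cos L = 0)
    (ha : θ a < L) (hb : L < θ b) : (∃ s, 0 < Real.cos (θ s)) ∧ ∃ s, Real.cos (θ s) < 0 := by
  set ε := min 1 (min (L - θ a) (θ b - L)) with hε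
  have h1 : ε ≤ 1 := min_le_left _ _
  have h2 : ε ≤ L - θ a := (min_le_right _ _).trans (min_le_left _ _)
  have h3 : ε ≤ θ b - L := (min_le_right _ _).trans (min_le_right _ _)
  have h0 : 0 < ε := lt_min one_pos (lt_min (by linarith) (by linarith))
  have hr : ∀ v ∈ Icc (θ a) (θ b), ∃ s, θ s = v := fun v hv =>
    mem_range_of_exists_le_of_exists_ge hθ ⟨a, hv.1⟩ ⟨b, hv.2⟩
  obtain ⟨s, hs⟩ := hr (L + ε) ⟨by linarith, by linarith⟩
  obtain ⟨t, ht⟩ := hr (L - ε) ⟨by linarith, by linarith⟩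
  have e1 : Real.cos (θ s) = -(Real.sin L * Real.sin ε) := by rw [hs, Real.cos_add, hL]; ring
  have e2 : Real.cos (θ t) = Real.sin L * Real.sin ε := by rw [ht, Real.cos_sub, hL]; ring
  have hsε : 0 < Real.sin ε := Real.sin_pos_of_pos_of_le_one h0 h1
  have hsL : Real.sin L ≠ 0 := fun h => by
    have := Real.cos_sq_add_sin_sq L
    rw [hL, h] at this
    norm_num at this
  rcases hsL.lt_or_gt with h | h
  · have := mul_neg_of_neg_of_pos h hsε
    exact ⟨⟨s, by linarith⟩, ⟨t, by linarith⟩⟩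
  · have := mul_pos h hsε
    exact ⟨⟨t, by linarith⟩, ⟨s, by linarith⟩⟩

theorem exists_cos_eq_zero_of_pi_lt {u v : ℝ} (h : u + Real.pi < v) :
    ∃ L, Real.cos L = 0 ∧ u < L ∧ L < v := by
  have hpi := Real.pi_pos
  set k := ⌊(u - Real.pi / 2) / Real.pi⌋ with hk
  have h1 := Int.floor_le ((u - Real.pi / 2) / Real.pi)
  have h2 := Int.lt_floor_add_one ((u - Real.pi / 2) / Real.pi)
  rw [le_div_iff₀ hpi] at h1
  rw [div_lt_iff₀ hpi] at h2
  refine ⟨Real.pi / 2 + (k + 1 : ℤ) * Real.pi, ?_, ?_, ?_⟩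
  · rw [Real.cos_eq_zero_iff]
    exact ⟨k + 1, by push_cast; ring⟩
  · push_cast
    linarith
  · push_cast
    linarith

theorem IsWindingAngle.of_crossing (hθ : ContDiff ℝ ∞ θ)
    (hn : ∀ s, θ (s + 1) = θ s + 2 * Real.pi * n) {L a b : ℝ} (hL : Real.cos L = 0)
    (ha : θ a < L) (hb : L < θ b) : IsWindingAngle n θ :=
  ⟨hθ, hn, (cos_signs_of_crossing hθ.continuous hL ha hb).1,
    (cos_signs_of_crossing hθ.continuous hL ha hb).2⟩

theorem IsWindingAngle.exists_crossing (h : IsWindingAngle n θ) :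
    ∃ L a b, Real.cos L = 0 ∧ θ a < L ∧ L < θ b := by
  obtain ⟨p, hp⟩ := h.exists_pos
  obtain ⟨q, hq⟩ := h.exists_neg
  have : (0 : ℝ) ∈ Real.cos '' uIcc (θ p) (θ q) :=
    intermediate_value_uIcc Real.continuous_cos.continuousOn (mem_uIcc.2 (Or.inr ⟨hq.le, hp.le⟩))
  obtain ⟨L, hL, hL0⟩ := this
  have h1 : L ≠ θ p := fun h => by rw [← h, hL0] at hp; exact lt_irrefl _ hp
  have h2 : L ≠ θ q := fun h => by rw [← h, hL0] at hq; exact lt_irrefl _ hq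
  rcases mem_uIcc.1 hL with ⟨h3, h4⟩ | ⟨h3, h4⟩
  · exact ⟨L, p, q, hL0, lt_of_le_of_ne h3 h1.symm, lt_of_le_of_ne h4 h2⟩
  · exact ⟨L, q, p, hL0, lt_of_le_of_ne h3 h2.symm, lt_of_le_of_ne h4 h1⟩

theorem map_add_int (hn : ∀ s, θ (s + 1) = θ s + 2 * Real.pi * n) (s : ℝ) (k : ℤ) :
    θ (s + k) = θ s + 2 * Real.pi * n * k := by
  have hp : Function.Periodic (fun s => θ s - 2 * Real.pi * n * s) 1 := fun s => by
    simp only [hn s]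
    ring
  have := hp.int_mul k s
  simp only [mul_one] at this
  linear_combination this

theorem IsWindingAngle.of_ne_zero (hn0 : n ≠ 0) (hθ : ContDiff ℝ ∞ θ)
    (hn : ∀ s, θ (s + 1) = θ s + 2 * Real.pi * n) : IsWindingAngle n θ := by
  have hc : 0 < 2 * Real.pi * (n : ℝ) ^ 2 := by
    have : (n : ℝ) ≠ 0 := by exact_mod_cast hn0
    positivity
  obtain ⟨j, hj⟩ := exists_nat_gt ((|Real.pi / 2| + |θ 0|) / (2 * Real.pi * (n : ℝ) ^ 2))
  rw [div_lt_iff₀ hc] at hj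
  have e1 := map_add_int hn 0 (n * j)
  have e2 := map_add_int hn 0 (-(n * j))
  push_cast at e1 e2
  have h1 := abs_le.1 (le_refl |Real.pi / 2|)
  have h2 := abs_le.1 (le_refl |θ 0|)
  exact .of_crossing hθ hn Real.cos_pi_div_two (a := 0 + -(n * j : ℝ)) (b := 0 + (n * j : ℝ))
    (by rw [e2]; nlinarith) (by rw [e1]; nlinarith)

/-- Large multiples of winding angles of degree zero can be joined to a standard oscillation. -/
theorem IsWindingAngle.joined_cos (h : IsWindingAngle 0 θ) :
    ∃ τ M₀, ∀ M ≥ M₀, SmoothlyJoined (IsWindingAngle 0) θ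
      fun s => M * Real.cos (2 * Real.pi * (s - τ)) := by
  obtain ⟨L, a, b, hL, ha, hb⟩ := h.exists_crossing
  have hper : ∀ s, θ (s + 1) = θ s := fun s => by simpa using h.map_add_one s
  have hab : Real.cos (2 * Real.pi * (a - b)) < 1 := by
    refine lt_of_le_of_ne (Real.cos_le_one _) fun h1 => ?_
    obtain ⟨k, hk⟩ := (Real.cos_eq_one_iff _).1 h1
    have e : a = b + k := by
      have : 2 * Real.pi * (k - (a - b)) = 0 := by linarith
      rcases mul_eq_zero.1 this with h0 | h0
      · exact absurd h0 (by positivity)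
      · linarith
    have := map_add_int h.map_add_one b k
    rw [← e] at this
    simp at this
    linarith
  set δ := min (θ b - θ a) (1 - Real.cos (2 * Real.pi * (a - b)))
  have hδ : 0 < δ := lt_min (by linarith) (by linarith)
  have hδ1 : δ ≤ θ b - θ a := min_le_left _ _
  have hδ2 : δ ≤ 1 - Real.cos (2 * Real.pi * (a - b)) := min_le_right _ _
  refine ⟨b, 4 / δ, fun M hM => ?_⟩
  have hMδ : 4 ≤ M * δ := by rwa [ge_iff_le, div_le_iff₀ hδ] at hM
  have hM0 : 0 < M := lt_of_lt_of_le (by positivity) hM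
  have hθs := h.smooth
  have s1 : SmoothlyJoined (IsWindingAngle 0) θ fun s => L + M * (θ s - L) := by
    have hK : ContDiff ℝ ∞ (Function.uncurry fun t s : ℝ => L + (1 - t + t * M) * (θ s - L)) := by
      have : ContDiff ℝ ∞ fun p : ℝ × ℝ => L + (1 - p.1 + p.1 * M) * (θ p.2 - L) := by fun_prop
      exact this
    convert! SmoothlyJoined.of_segment (P := IsWindingAngle 0) hK fun t ht => ?_ using 1
    · funext s; ring
    · funext s; ring
    · have hpos : 0 < 1 - t + t * M := by
        rcases eq_or_lt_of_le ht.1 with h0 | h0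
        · rw [← h0]; norm_num
        · have := mul_pos h0 hM0
          linarith [ht.2]
      refine .of_crossing (by fun_prop) (fun s => by simp [hper s]) hL (a := a) (b := b) ?_ ?_
      · nlinarith
      · nlinarith
  have s2 : SmoothlyJoined (IsWindingAngle 0) (fun s => L + M * (θ s - L))
      fun s => M * Real.cos (2 * Real.pi * (s - b)) := by
    have hK : ContDiff ℝ ∞ (Function.uncurry fun t s : ℝ => (1 - t) * (L + M * (θ s - L))
        + t * (M * Real.cos (2 * Real.pi * (s - b)))) := by
      have : ContDiff ℝ ∞ fun p : ℝ × ℝ => (1 - p.1) * (L + M * (θ p.2 - L))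
        + p.1 * (M * Real.cos (2 * Real.pi * (p.2 - b))) := by fun_prop
      exact this
    convert! SmoothlyJoined.of_segment (P := IsWindingAngle 0) hK fun t ht => ?_ using 1
    · funext s; ring
    · funext s; ring
    · have hcos : Real.cos (2 * Real.pi * (b - b)) = 1 := by simp
      obtain ⟨L', hL', h1, h2⟩ := exists_cos_eq_zero_of_pi_lt
        (u := (1 - t) * (L + M * (θ a - L)) + t * (M * Real.cos (2 * Real.pi * (a - b))))
        (v := (1 - t) * (L + M * (θ b - L)) + t * (M * Real.cos (2 * Real.pi * (b - b)))) (by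
          rw [hcos]
          have e1 : M * δ ≤ M * (θ b - θ a) := by gcongr
          have e2 : M * δ ≤ M * (1 - Real.cos (2 * Real.pi * (a - b))) := by gcongr
          have e3 := mul_le_mul_of_nonneg_left e1 (sub_nonneg.2 ht.2)
          have e4 := mul_le_mul_of_nonneg_left e2 ht.1
          have := Real.pi_lt_four
          nlinarith)
      refine .of_crossing (by fun_prop) (fun s => ?_) hL' (a := a) (b := b) h1 h2
      rw [hper s, show 2 * Real.pi * (s + 1 - b) = 2 * Real.pi * (s - b) + 2 * Real.pi by ring,
        Real.cos_add_two_pi]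
      simp
  exact s1.trans s2

theorem joined_cos_cos {M : ℝ} (hM : 4 ≤ M) (τ τ' : ℝ) :
    SmoothlyJoined (IsWindingAngle 0) (fun s => M * Real.cos (2 * Real.pi * (s - τ)))
      fun s => M * Real.cos (2 * Real.pi * (s - τ')) := by
  have hK : ContDiff ℝ ∞ (Function.uncurry fun t s : ℝ =>
      M * Real.cos (2 * Real.pi * (s - ((1 - t) * τ + t * τ')))) := by
    have : ContDiff ℝ ∞ fun p : ℝ × ℝ =>
      M * Real.cos (2 * Real.pi * (p.2 - ((1 - p.1) * τ + p.1 * τ'))) := by fun_prop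
    exact this
  convert! SmoothlyJoined.of_segment (P := IsWindingAngle 0) hK fun t ht => ?_ using 1
  · funext s; simp
  · funext s; simp
  · have hpi := Real.pi_lt_four
    have hpi' := Real.pi_pos
    refine .of_crossing (by fun_prop) (fun s => ?_) Real.cos_pi_div_two
      (a := (1 - t) * τ + t * τ' + 1 / 2) (b := (1 - t) * τ + t * τ') ?_ ?_
    · rw [show 2 * Real.pi * (s + 1 - ((1 - t) * τ + t * τ'))
          = 2 * Real.pi * (s - ((1 - t) * τ + t * τ')) + 2 * Real.pi by ring, Real.cos_add_two_pi]
      simp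
    · rw [show 2 * Real.pi * ((1 - t) * τ + t * τ' + 1 / 2 - ((1 - t) * τ + t * τ')) = Real.pi by
        ring, Real.cos_pi]
      linarith
    · rw [sub_self, mul_zero, Real.cos_zero]
      linarith

theorem IsWindingAngle.joined {φ : ℝ → ℝ} (h : IsWindingAngle n θ) (h' : IsWindingAngle n φ) :
    SmoothlyJoined (IsWindingAngle n) θ φ := by
  rcases eq_or_ne n 0 with rfl | hn
  · obtain ⟨τ, M₀, hτ⟩ := h.joined_cos
    obtain ⟨τ', M₁, hτ'⟩ := h'.joined_cos
    set M := max 4 (max M₀ M₁)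
    exact ((hτ M ((le_max_left _ _).trans (le_max_right _ _))).trans
      (joined_cos_cos (le_max_left _ _) τ τ')).trans
      (hτ' M ((le_max_right _ _).trans (le_max_right _ _))).symm
  · have hθs := h.smooth
    have hφs := h'.smooth
    have hK : ContDiff ℝ ∞ (Function.uncurry fun t s : ℝ => (1 - t) * θ s + t * φ s) := by
      have : ContDiff ℝ ∞ fun p : ℝ × ℝ => (1 - p.1) * θ p.2 + p.1 * φ p.2 := by fun_prop
      exact this
    convert! SmoothlyJoined.of_segment (P := IsWindingAngle n) hK fun t _ => ?_ using 1
    · funext s; ring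
    · funext s; ring
    · refine .of_ne_zero hn (by fun_prop) fun s => ?_
      rw [h.map_add_one, h'.map_add_one]
      ring

end Winding

section LoopOfAngle

/-- The integral of `c⁺` over a period, weighted by a smooth cutoff supported in `c > 0`. -/
noncomputable def positiveMass (c : ℝ → ℝ) : ℝ := ∫ u in 0..1, c u * expNegInvGlue (c u)

/-- A positive weight making the mean of `c` vanish, when `c` takes both signs. -/
noncomputable def balancingWeight (c : ℝ → ℝ) (s : ℝ) : ℝ :=
  1 + ((∫ u in 0..1, c u) ^ 2 + 1 - ∫ u in 0..1, c u) / (2 * positiveMass c) * expNegInvGlue (c s)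
    + ((∫ u in 0..1, c u) ^ 2 + 1 + ∫ u in 0..1, c u) / (2 * positiveMass fun u => -c u)
      * expNegInvGlue (-c s)

/-- A closed plane curve whose velocity has angle `θ` wherever it is vertical, and horizontal
component with the sign of `cos θ`. -/
noncomputable def loopOfAngle (θ : ℝ → ℝ) (s : ℝ) : ℝ × ℝ :=
  (∫ u in 0..s, balancingWeight (fun u => Real.cos (θ u)) u * Real.cos (θ u),
    ∫ u in 0..s, (Real.sin (θ u)
      - (∫ v in 0..1, Real.sin (θ v)) / (∫ v in 0..1, Real.cos (θ v) ^ 2) * Real.cos (θ u) ^ 2))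

variable {c : ℝ → ℝ}

theorem mul_expNegInvGlue_nonneg (v : ℝ) : 0 ≤ v * expNegInvGlue v := by
  rcases le_total 0 v with h | h
  · exact mul_nonneg h (expNegInvGlue.nonneg v)
  · rw [expNegInvGlue.zero_of_nonpos h, mul_zero]

theorem positiveMass_pos (hc : Continuous c) (hp : Function.Periodic c 1) (h : ∃ s, 0 < c s) :
    0 < positiveMass c := by
  obtain ⟨s, hs⟩ := h
  have hE : Continuous expNegInvGlue := (expNegInvGlue.contDiff (n := 0)).continuous
  refine intervalIntegral.integral_pos zero_lt_one (by fun_prop)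
    (fun u _ => mul_expNegInvGlue_nonneg _)
    ⟨Int.fract s, ⟨Int.fract_nonneg _, (Int.fract_lt_one _).le⟩, ?_⟩
  rw [hp.map_fract]
  exact mul_pos hs (expNegInvGlue.pos_of_pos hs)

theorem balancingWeight_pos (hp : 0 < positiveMass c) (hn : 0 < positiveMass fun u => -c u)
    (s : ℝ) : 0 < balancingWeight c s := by
  unfold balancingWeight
  set m := ∫ u in 0..1, c u
  have h1 : 0 < m ^ 2 + 1 - m := by nlinarith [sq_nonneg (m - 1 / 2)]
  have h2 : 0 < m ^ 2 + 1 + m := by nlinarith [sq_nonneg (m + 1 / 2)]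
  have h3 := expNegInvGlue.nonneg (c s)
  have h4 := expNegInvGlue.nonneg (-c s)
  positivity

theorem integral_balancingWeight_mul (hc : Continuous c) (hp : 0 < positiveMass c)
    (hn : 0 < positiveMass fun u => -c u) : ∫ u in 0..1, balancingWeight c u * c u = 0 := by
  have hE : Continuous expNegInvGlue := (expNegInvGlue.contDiff (n := 0)).continuous
  unfold balancingWeight
  set m := ∫ u in 0..1, c u with hm
  set α := (m ^ 2 + 1 - m) / (2 * positiveMass c) with hα
  set β := (m ^ 2 + 1 + m) / (2 * positiveMass fun u => -c u) with hβ
  have e : ∀ u, (1 + α * expNegInvGlue (c u) + β * expNegInvGlue (-c u)) * c u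
      = (c u + α * (c u * expNegInvGlue (c u))) - β * (-c u * expNegInvGlue (-c u)) :=
    fun u => by ring
  have i1 : IntervalIntegrable c volume 0 1 := hc.intervalIntegrable _ _
  have i2 : IntervalIntegrable (fun u => α * (c u * expNegInvGlue (c u))) volume 0 1 :=
    Continuous.intervalIntegrable (by fun_prop) _ _
  have i3 : IntervalIntegrable (fun u => β * (-c u * expNegInvGlue (-c u))) volume 0 1 :=
    Continuous.intervalIntegrable (by fun_prop) _ _
  simp_rw [e]
  rw [intervalIntegral.integral_sub (i1.add i2) i3, intervalIntegral.integral_add i1 i2,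
    intervalIntegral.integral_const_mul, intervalIntegral.integral_const_mul, ← hm]
  change m + α * positiveMass c - β * positiveMass (fun u => -c u) = 0
  rw [hα, hβ]
  field_simp
  ring

variable {E : Type} [NormedAddCommGroup E] [NormedSpace ℝ E] [FiniteDimensional ℝ E]

theorem contDiff_integral_zero_one {f : E → ℝ → ℝ} (hf : ContDiff ℝ ∞ (Function.uncurry f)) :
    ContDiff ℝ ∞ fun e => ∫ u in 0..1, f e u :=
  (contDiff_integral hf).comp (contDiff_id.prodMk contDiff_const)

theorem contDiff_balancingWeight {c : E → ℝ → ℝ} (hc : ContDiff ℝ ∞ (Function.uncurry c))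
    (hp : ∀ e, 0 < positiveMass (c e)) (hn : ∀ e, 0 < positiveMass fun u => -c e u) :
    ContDiff ℝ ∞ fun q : E × ℝ => balancingWeight (c q.1) q.2 := by
  have hE : ContDiff ℝ ∞ expNegInvGlue := expNegInvGlue.contDiff
  have hcE : ContDiff ℝ ∞ fun q : E × ℝ => expNegInvGlue (c q.1 q.2) := hE.comp hc
  have hcE' : ContDiff ℝ ∞ fun q : E × ℝ => expNegInvGlue (-c q.1 q.2) := hE.comp hc.neg
  have hm : ContDiff ℝ ∞ fun q : E × ℝ => ∫ u in 0..1, c q.1 u :=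
    (contDiff_integral_zero_one hc).comp contDiff_fst
  have hA : ContDiff ℝ ∞ fun q : E × ℝ => positiveMass (c q.1) :=
    (contDiff_integral_zero_one (f := fun e u => c e u * expNegInvGlue (c e u))
      (hc.mul hcE)).comp contDiff_fst
  have hB : ContDiff ℝ ∞ fun q : E × ℝ => positiveMass fun u => -c q.1 u :=
    (contDiff_integral_zero_one (f := fun e u => -c e u * expNegInvGlue (-c e u))
      (hc.neg.mul hcE')).comp contDiff_fst
  unfold balancingWeight
  exact (contDiff_const.add (((((hm.pow 2).add contDiff_const).sub hm).div
    (contDiff_const.mul hA) fun q => (mul_pos two_pos (hp q.1)).ne').mul hcE)).add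
    (((((hm.pow 2).add contDiff_const).add hm).div
    (contDiff_const.mul hB) fun q => (mul_pos two_pos (hn q.1)).ne').mul hcE')

namespace IsWindingAngle

variable {θ : ℝ → ℝ} {n : ℤ}

theorem periodic_cos (h : IsWindingAngle n θ) : Function.Periodic (fun s => Real.cos (θ s)) 1 :=
  fun s => by
    simp only [h.map_add_one s]
    rw [mul_comm (2 * Real.pi)]
    exact Real.cos_add_int_mul_two_pi _ _

theorem periodic_sin (h : IsWindingAngle n θ) : Function.Periodic (fun s => Real.sin (θ s)) 1 :=
  fun s => by
    simp only [h.map_add_one s]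
    rw [mul_comm (2 * Real.pi)]
    exact Real.sin_add_int_mul_two_pi _ _

theorem positiveMass_cos_pos (h : IsWindingAngle n θ) :
    0 < positiveMass fun s => Real.cos (θ s) :=
  positiveMass_pos (Real.continuous_cos.comp h.smooth.continuous) h.periodic_cos h.exists_pos

theorem positiveMass_neg_cos_pos (h : IsWindingAngle n θ) :
    0 < positiveMass fun s => -Real.cos (θ s) :=
  positiveMass_pos (Real.continuous_cos.comp h.smooth.continuous).neg
    (fun s => congrArg Neg.neg (h.periodic_cos s))
    (h.exists_neg.imp fun _ => neg_pos.2)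

theorem integral_cos_sq_pos (h : IsWindingAngle n θ) : 0 < ∫ v in 0..1, Real.cos (θ v) ^ 2 := by
  obtain ⟨s, hs⟩ := h.exists_pos
  have hθ := h.smooth.continuous
  refine intervalIntegral.integral_pos zero_lt_one (by fun_prop) (fun u _ => sq_nonneg _)
    ⟨Int.fract s, ⟨Int.fract_nonneg _, (Int.fract_lt_one _).le⟩, ?_⟩
  rw [show Real.cos (θ (Int.fract s)) = Real.cos (θ s) from h.periodic_cos.map_fract s]
  positivity

theorem contDiff_loopOfAngle {Θ : ℝ → ℝ → ℝ} (hΘ : ContDiff ℝ ∞ (Function.uncurry Θ))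
    (h : ∀ t, IsWindingAngle n (Θ t)) :
    ContDiff ℝ ∞ (Function.uncurry fun t => loopOfAngle (Θ t)) := by
  have hcos : ContDiff ℝ ∞ fun q : ℝ × ℝ => Real.cos (Θ q.1 q.2) := Real.contDiff_cos.comp hΘ
  have hsin : ContDiff ℝ ∞ fun q : ℝ × ℝ => Real.sin (Θ q.1 q.2) := Real.contDiff_sin.comp hΘ
  have hw := contDiff_balancingWeight (c := fun t u => Real.cos (Θ t u)) hcos
    (fun t => (h t).positiveMass_cos_pos) fun t => (h t).positiveMass_neg_cos_pos
  have hm : ContDiff ℝ ∞ fun q : ℝ × ℝ => ∫ v in 0..1, Real.sin (Θ q.1 v) :=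
    (contDiff_integral_zero_one (f := fun t v => Real.sin (Θ t v)) hsin).comp contDiff_fst
  have hm' : ContDiff ℝ ∞ fun q : ℝ × ℝ => ∫ v in 0..1, Real.cos (Θ q.1 v) ^ 2 :=
    (contDiff_integral_zero_one (f := fun t v => Real.cos (Θ t v) ^ 2)
      (hcos.pow 2)).comp contDiff_fst
  exact (contDiff_integral (hw.mul hcos)).prodMk (contDiff_integral (hsin.sub
    ((hm.div hm' fun q => (h q.1).integral_cos_sq_pos.ne').mul (hcos.pow 2))))

theorem hasDerivAt_loopOfAngle (h : IsWindingAngle n θ) (s : ℝ) :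
    HasDerivAt (fun s => (loopOfAngle θ s).1)
      (balancingWeight (fun u => Real.cos (θ u)) s * Real.cos (θ s)) s ∧
    HasDerivAt (fun s => (loopOfAngle θ s).2)
      (Real.sin (θ s) - (∫ v in 0..1, Real.sin (θ v)) / (∫ v in 0..1, Real.cos (θ v) ^ 2)
        * Real.cos (θ s) ^ 2) s := by
  have hθ := h.smooth.continuous
  have hE : Continuous expNegInvGlue := (expNegInvGlue.contDiff (n := 0)).continuous
  constructor
  · have hw : Continuous (balancingWeight fun u => Real.cos (θ u)) := by
      unfold balancingWeight
      fun_prop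
    exact (Continuous.integral_hasStrictDerivAt (by fun_prop) 0 s).hasDerivAt
  · exact (Continuous.integral_hasStrictDerivAt (by fun_prop) 0 s).hasDerivAt

theorem isPlaneLoop_loopOfAngle (h : IsWindingAngle n θ) :
    IsPlaneLoop (fun s => (loopOfAngle θ s).1) fun s => (loopOfAngle θ s).2 := by
  have hθ := h.smooth.continuous
  have hE : Continuous expNegInvGlue := (expNegInvGlue.contDiff (n := 0)).continuous
  have hs : ContDiff ℝ ∞ (loopOfAngle θ) :=
    (contDiff_loopOfAngle (Θ := fun _ => θ) (h.smooth.comp contDiff_snd) fun _ => h).comp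
      ((contDiff_const (c := (0 : ℝ))).prodMk contDiff_id)
  have hp := h.positiveMass_cos_pos
  have hn := h.positiveMass_neg_cos_pos
  refine ⟨contDiff_fst.comp hs, contDiff_snd.comp hs, fun s => ?_, fun s => ?_, fun s h0 => ?_⟩
  · have hw : Continuous (balancingWeight fun u => Real.cos (θ u)) := by
      unfold balancingWeight
      fun_prop
    have hper : Function.Periodic
        (fun u => balancingWeight (fun u => Real.cos (θ u)) u * Real.cos (θ u)) 1 := fun u => by
      have := h.periodic_cos u
      simp only at this
      simp only [balancingWeight, this]
    have := hper.intervalIntegral_add_eq_add 0 s fun _ _ =>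
      Continuous.intervalIntegrable (by fun_prop) _ _
    rw [zero_add, integral_balancingWeight_mul (by fun_prop) hp hn, add_zero] at this
    exact this
  · set κ := (∫ v in 0..1, Real.sin (θ v)) / (∫ v in 0..1, Real.cos (θ v) ^ 2) with hκ
    have hper : Function.Periodic (fun u => Real.sin (θ u) - κ * Real.cos (θ u) ^ 2) 1 :=
      fun u => by
        have h1 := h.periodic_cos u
        have h2 := h.periodic_sin u
        simp only at h1 h2
        simp only [h1, h2]
    have hzero : ∫ u in 0..1, (Real.sin (θ u) - κ * Real.cos (θ u) ^ 2) = 0 := by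
      rw [intervalIntegral.integral_sub (Continuous.intervalIntegrable (by fun_prop) _ _)
        (Continuous.intervalIntegrable (by fun_prop) _ _), intervalIntegral.integral_const_mul, hκ,
        div_mul_cancel₀ _ h.integral_cos_sq_pos.ne', sub_self]
    have := hper.intervalIntegral_add_eq_add 0 s fun _ _ =>
      Continuous.intervalIntegrable (by fun_prop) _ _
    rw [zero_add, hzero, add_zero] at this
    exact this
  · rw [(h.hasDerivAt_loopOfAngle s).1.deriv] at h0
    rw [(h.hasDerivAt_loopOfAngle s).2.deriv]
    have hc := (mul_eq_zero.1 h0).resolve_left (balancingWeight_pos hp hn s).ne'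
    have := Real.cos_sq_add_sin_sq (θ s)
    rw [hc] at this ⊢
    intro h1
    simp only [ne_eq, OfNat.ofNat_ne_zero, not_false_eq_true, zero_pow, mul_zero, sub_zero] at h1
    rw [h1] at this
    norm_num at this

end IsWindingAngle

end LoopOfAngle

section WhitneyGraustein

variable {x y θ : ℝ → ℝ}

theorem exists_deriv_pos_of_periodic (hx : ContDiff ℝ ∞ x) (hp : Function.Periodic x 1) {c : ℝ}
    (hc : c ∈ Ioo (0 : ℝ) 1) (h0 : deriv x c ≠ 0) : ∃ s, 0 < deriv x s := by
  by_contra! hcon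
  have hd := (contDiff_deriv hx).continuous
  have h1 : ∫ u in 0..1, deriv x u = 0 := by
    rw [integral_deriv_eq_sub (fun u _ => hx.differentiable (by simp) u)
      (hd.intervalIntegrable _ _)]
    simpa [sub_eq_zero] using hp 0
  have h2 : 0 < ∫ u in 0..1, -deriv x u :=
    intervalIntegral.integral_pos zero_lt_one hd.neg.continuousOn
      (fun u _ => neg_nonneg.2 (hcon u))
      ⟨c, ⟨hc.1.le, hc.2.le⟩, neg_pos.2 (lt_of_le_of_ne (hcon c) h0)⟩
  rw [intervalIntegral.integral_neg, h1, neg_zero] at h2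
  exact lt_irrefl _ h2

theorem IsPlaneLoop.isWindingAngle (h : IsPlaneLoop x y) (hθ : IsAngle (deriv x) (deriv y) θ)
    {n : ℤ} (hn : θ 1 - θ 0 = 2 * Real.pi * n) : IsWindingAngle n θ := by
  obtain ⟨c, hc, hc0⟩ := h.exists_deriv_fst_ne_zero
  refine ⟨hθ.contDiff (contDiff_deriv h.smooth_fst) (contDiff_deriv h.smooth_snd), fun s => ?_,
    ?_, ?_⟩
  · rw [hθ.map_add_one h.periodic_fst.deriv_of_periodic h.periodic_snd.deriv_of_periodic, hn]
  · obtain ⟨s, hs⟩ := exists_deriv_pos_of_periodic h.smooth_fst h.periodic_fst hc hc0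
    obtain ⟨r, hr, e, -⟩ := hθ.2 s
    rw [e] at hs
    exact ⟨s, pos_of_mul_pos_right hs hr.le⟩
  · obtain ⟨s, hs⟩ := exists_deriv_pos_of_periodic (x := fun s => -x s) h.smooth_fst.neg
      (fun s => congrArg Neg.neg (h.periodic_fst s)) hc (by simpa [deriv.fun_neg] using hc0)
    obtain ⟨r, hr, e, -⟩ := hθ.2 s
    rw [deriv.fun_neg, e, ← mul_neg] at hs
    exact ⟨s, neg_pos.1 (pos_of_mul_pos_right hs hr.le)⟩

/-- A closed immersed plane curve can be joined to the standard curve with the same angle. -/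
theorem IsPlaneLoop.joined_loopOfAngle (h : IsPlaneLoop x y)
    (hθ : IsAngle (deriv x) (deriv y) θ) {n : ℤ} (hw : IsWindingAngle n θ) :
    SmoothlyJoined (fun f => IsPlaneLoop (fun s => (f s).1) fun s => (f s).2)
      (fun s => (x s, y s)) (loopOfAngle θ) := by
  have hL := hw.isPlaneLoop_loopOfAngle
  have hx := h.smooth_fst
  have hy := h.smooth_snd
  have hX := hL.smooth_fst
  have hY := hL.smooth_snd
  have hK : ContDiff ℝ ∞ (Function.uncurry fun t s : ℝ =>
      ((1 - t) * x s + t * (loopOfAngle θ s).1, (1 - t) * y s + t * (loopOfAngle θ s).2)) := by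
    have h1 : ContDiff ℝ ∞ fun p : ℝ × ℝ =>
      (1 - p.1) * x p.2 + p.1 * (loopOfAngle θ p.2).1 :=
      ((contDiff_const.sub contDiff_fst).mul (hx.comp contDiff_snd)).add
        (contDiff_fst.mul (hX.comp contDiff_snd))
    have h2 : ContDiff ℝ ∞ fun p : ℝ × ℝ =>
      (1 - p.1) * y p.2 + p.1 * (loopOfAngle θ p.2).2 :=
      ((contDiff_const.sub contDiff_fst).mul (hy.comp contDiff_snd)).add
        (contDiff_fst.mul (hY.comp contDiff_snd))
    exact h1.prodMk h2
  convert! SmoothlyJoined.of_segment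
    (P := fun f => IsPlaneLoop (fun s => (f s).1) fun s => (f s).2) hK fun t ht => ?_ using 1
  · funext s
    simp
  · funext s
    simp
  · refine ⟨by fun_prop, by fun_prop, fun s => ?_, fun s => ?_, fun s h0 h1 => ?_⟩
    · have : (loopOfAngle θ (s + 1)).1 = (loopOfAngle θ s).1 := hL.periodic_fst s
      simp only [h.periodic_fst s, this]
    · have : (loopOfAngle θ (s + 1)).2 = (loopOfAngle θ s).2 := hL.periodic_snd s
      simp only [h.periodic_snd s, this]
    · have d1 := ((hx.differentiable (by simp) s).hasDerivAt.const_mul (1 - t)).add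
        ((hw.hasDerivAt_loopOfAngle s).1.const_mul t)
      have d2 := ((hy.differentiable (by simp) s).hasDerivAt.const_mul (1 - t)).add
        ((hw.hasDerivAt_loopOfAngle s).2.const_mul t)
      replace h0 := d1.deriv.symm.trans h0
      replace h1 := d2.deriv.symm.trans h1
      obtain ⟨r, hr, e1, e2⟩ := hθ.2 s
      have hpos : ∀ r' > 0, 0 < (1 - t) * r + t * r' := fun r' hr' => by
        rcases eq_or_lt_of_le ht.1 with h | h
        · rw [← h]; simpa using hr
        · have h3 := mul_pos h hr'
          have h4 := mul_nonneg (sub_nonneg.2 ht.2) hr.le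
          linarith
      have hc : Real.cos (θ s) = 0 := by
        rw [e1] at h0
        refine (mul_eq_zero.1 (?_ : _ * Real.cos (θ s) = 0)).resolve_left
          (hpos _ (balancingWeight_pos hw.positiveMass_cos_pos hw.positiveMass_neg_cos_pos s)).ne'
        linear_combination h0
      rw [e2, hc] at h1
      have hsin : Real.sin (θ s) = 0 :=
        (mul_eq_zero.1 (by linear_combination h1 :
          ((1 - t) * r + t * 1) * Real.sin (θ s) = 0)).resolve_left (hpos 1 one_pos).ne'
      have := Real.cos_sq_add_sin_sq (θ s)
      rw [hc, hsin] at this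
      norm_num at this

/-- Closed immersed plane curves with the same rotation number are regularly homotopic. -/
theorem IsPlaneLoop.joined {x' y' φ : ℝ → ℝ} {n : ℤ} (h : IsPlaneLoop x y)
    (h' : IsPlaneLoop x' y') (hθ : IsAngle (deriv x) (deriv y) θ)
    (hφ : IsAngle (deriv x') (deriv y') φ) (hn : θ 1 - θ 0 = 2 * Real.pi * n)
    (hn' : φ 1 - φ 0 = 2 * Real.pi * n) :
    SmoothlyJoined (fun f => IsPlaneLoop (fun s => (f s).1) fun s => (f s).2)
      (fun s => (x s, y s)) fun s => (x' s, y' s) := by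
  have hw := h.isWindingAngle hθ hn
  have hw' := h'.isWindingAngle hφ hn'
  obtain ⟨Θ, hΘ, hP, h0, h1⟩ := hw.joined hw'
  have hmid : SmoothlyJoined (fun f => IsPlaneLoop (fun s => (f s).1) fun s => (f s).2)
      (loopOfAngle θ) (loopOfAngle φ) :=
    ⟨fun t => loopOfAngle (Θ t), IsWindingAngle.contDiff_loopOfAngle hΘ hP,
      fun t => (hP t).isPlaneLoop_loopOfAngle, fun t ht => congrArg loopOfAngle (h0 t ht),
      fun t ht => congrArg loopOfAngle (h1 t ht)⟩
  exact ((h.joined_loopOfAngle hθ hw).trans hmid).trans (h'.joined_loopOfAngle hφ hw').symm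

end WhitneyGraustein

/-- The differences between the parameters `s` and `s + h` of the last three coordinates
(up to a shear) of the horizontal lift of `(x, y)`. -/
noncomputable def response (x y : ℝ → ℝ) (s h : ℝ) : Fin 3 → ℝ :=
  ![balance x y (s + h) - balance x y s, moment 0 x (balance x y) s (s + h),
    moment 1 x (balance x y) s (s + h)]

theorem isDoublePoint_iff {x y : ℝ → ℝ} {s h : ℝ} :
    IsDoublePoint x y s h ↔ x (s + h) - x s = 0 ∧ response x y s h = 0 := by
  rw [IsDoublePoint, response, sub_eq_zero, ← List.ofFn_inj]
  simp [sub_eq_zero]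

section Linearity

variable {x y η : ℝ → ℝ}

theorem balance_add_mul (hx : ContDiff ℝ ∞ x) (hy : Continuous y) (hη : Continuous η) (c : ℝ) :
    balance x (fun s => y s + c * η s) = fun s => balance x y s + c * balance x η s := by
  funext s
  simp only [balance, coeffZero, coeffOne, moment_add_mul _ hx hy hη]
  ring

theorem continuous_balance (hx : ContDiff ℝ ∞ x) (hy : Continuous y) :
    Continuous (balance x y) :=
  (hy.sub (continuous_const.mul (contDiff_corrector hx 0).continuous)).sub
    (continuous_const.mul (contDiff_corrector hx 1).continuous)

theorem response_add_mul (hx : ContDiff ℝ ∞ x) (hy : Continuous y) (hη : Continuous η)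
    (c s h : ℝ) :
    response x (fun s => y s + c * η s) s h = response x y s h + c • response x η s h := by
  have h1 := continuous_balance hx hy
  have h2 := continuous_balance hx hη
  simp only [response, balance_add_mul hx hy hη, moment_add_mul _ hx h1 h2]
  ext i
  fin_cases i <;> simp
  ring

theorem response_zero (x : ℝ → ℝ) (s h : ℝ) : response x (fun _ => 0) s h = 0 := by
  have : balance x (fun _ => 0) = fun _ => 0 :=
    balance_eq_self (by simp [moment]) (by simp [moment])
  simp [response, this, moment]

theorem response_sum {ι : Type} {η : ι → ℝ → ℝ} (hx : ContDiff ℝ ∞ x)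
    (hη : ∀ i, Continuous (η i)) (w : ι → ℝ) (s h : ℝ) (S : Finset ι) :
    response x (fun s => ∑ i ∈ S, w i * η i s) s h = ∑ i ∈ S, w i • response x (η i) s h := by
  classical
  induction S using Finset.induction_on with
  | empty => simpa using response_zero x s h
  | insert i S hi ih =>
    have hc : Continuous fun s => ∑ j ∈ S, w j * η j s :=
      continuous_finsetSum _ fun j _ => continuous_const.mul (hη j)
    rw [Finset.sum_insert hi, ← ih, add_comm, ← response_add_mul hx hc (hη i)]
    congr 1
    funext u
    rw [Finset.sum_insert hi, add_comm]

end Linearity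

/-- A function without critical points near `s₀` takes different values at nearby points. -/
theorem eventually_ne_of_deriv_ne_zero {T : Type*} [TopologicalSpace T]
    {f : T → ℝ → ℝ} {e₀ : T} {s₀ : ℝ}
    (hf : ∀ᶠ p in 𝓝 (e₀, s₀), deriv (f p.1) p.2 ≠ 0)
    (hc : ∀ᶠ p in 𝓝 (e₀, s₀), ContinuousAt (f p.1) p.2) :
    ∀ᶠ q : T × ℝ × ℝ in 𝓝 (e₀, s₀, 0), 0 < q.2.2 → f q.1 (q.2.1 + q.2.2) ≠ f q.1 q.2.1 := by
  have h := hf.and hc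
  rw [nhds_prod_eq, eventually_prod_iff] at h
  obtain ⟨pa, ha, pb, hb, hab⟩ := h
  obtain ⟨ε, hε, hball⟩ := Metric.eventually_nhds_iff.1 hb
  have h1 : ∀ᶠ q : T × ℝ × ℝ in 𝓝 (e₀, s₀, 0), pa q.1 := continuousAt_fst.eventually ha
  have h2 : ∀ᶠ q : T × ℝ × ℝ in 𝓝 (e₀, s₀, 0), dist q.2.1 s₀ < ε / 2 :=
    (by fun_prop : ContinuousAt (fun q : T × ℝ × ℝ => q.2.1) (e₀, s₀, 0)).eventually
      (Metric.ball_mem_nhds s₀ (half_pos hε))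
  have h3 : ∀ᶠ q : T × ℝ × ℝ in 𝓝 (e₀, s₀, 0), q.2.2 < ε / 2 :=
    (continuous_snd.comp continuous_snd).continuousAt.eventually (gt_mem_nhds (half_pos hε))
  filter_upwards [h1, h2, h3] with q hq1 hq2 hq3 hpos heq
  rw [Real.dist_eq, abs_lt] at hq2
  have hmem : ∀ u ∈ Icc q.2.1 (q.2.1 + q.2.2), pb u := fun u hu => hball (by
    rw [Real.dist_eq, abs_lt]
    constructor <;> linarith [hu.1, hu.2])
  obtain ⟨c, hc, hc0⟩ := exists_deriv_eq_zero (f := f q.1) (by linarith)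
    (fun u hu => (hab hq1 (hmem u hu)).2.continuousWithinAt) heq.symm
  exact (hab hq1 (hmem c ⟨hc.1.le, hc.2.le⟩)).1 hc0

section Family

variable {E : Type} [NormedAddCommGroup E] [NormedSpace ℝ E] {x y : E → ℝ → ℝ}

theorem contDiff_corrector_family (j : ℕ) (hx : ContDiff ℝ ∞ (Function.uncurry x)) :
    ContDiff ℝ ∞ (Function.uncurry fun e => corrector j (x e)) :=
  (hx.pow j).mul ((contDiff_deriv_param hx).pow 3)

theorem ContDiffAt.deriv_param {f : E → ℝ → ℝ} {q : E × ℝ}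
    (hf : ContDiffAt ℝ ∞ (Function.uncurry f) q) :
    ContinuousAt (fun p : E × ℝ => deriv (f p.1) p.2) q ∧
      ∀ᶠ p in 𝓝 q, ContinuousAt (f p.1) p.2 := by
  have h1 : ContDiffAt ℝ 1 (Function.uncurry f) q := hf.of_le (by simp)
  have hev : ∀ᶠ p in 𝓝 q, DifferentiableAt ℝ (Function.uncurry f) p :=
    (h1.eventually (by simp)).mono fun p hp => hp.differentiableAt (by simp)
  have hc : ∀ p : E × ℝ, HasDerivAt (fun u : ℝ => (p.1, u)) ((0 : E), (1 : ℝ)) p.2 := fun p =>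
    (hasDerivAt_const _ _).prodMk (hasDerivAt_id _)
  constructor
  · have h2 : ContinuousAt (fun p => fderiv ℝ (Function.uncurry f) p (0, 1)) q :=
      (h1.fderiv_right (m := 0) (by simp)).continuousAt.clm_apply continuousAt_const
    refine h2.congr ?_
    filter_upwards [hev] with p hp
    exact (hp.hasFDerivAt.comp_hasDerivAt p.2 (hc p)).deriv.symm
  · filter_upwards [hev] with p hp
    exact (hp.hasFDerivAt.comp_hasDerivAt p.2 (hc p)).continuousAt

variable [FiniteDimensional ℝ E]

theorem contDiff_moment_family (k : ℕ) (hx : ContDiff ℝ ∞ (Function.uncurry x))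
    (hy : ContDiff ℝ ∞ (Function.uncurry y)) :
    ContDiff ℝ ∞ fun q : E × ℝ × ℝ => moment k (x q.1) (y q.1) q.2.1 q.2.2 := by
  have hxe : ∀ e, ContDiff ℝ ∞ (x e) := fun e => hx.comp (contDiff_const.prodMk contDiff_id)
  have hye : ∀ e, ContDiff ℝ ∞ (y e) := fun e => hy.comp (contDiff_const.prodMk contDiff_id)
  have h0 : ContDiff ℝ ∞ fun p : E × ℝ => moment k (x p.1) (y p.1) 0 p.2 :=
    contDiff_integral (f := fun p : E × ℝ => y p.1 p.2 * x p.1 p.2 ^ k * deriv (x p.1) p.2)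
      ((hy.mul (hx.pow k)).mul (contDiff_deriv_param hx))
  have e : (fun q : E × ℝ × ℝ => moment k (x q.1) (y q.1) q.2.1 q.2.2) = fun q =>
      moment k (x q.1) (y q.1) 0 q.2.2 - moment k (x q.1) (y q.1) 0 q.2.1 :=
    funext fun q => (moment_sub k (hxe q.1) (hye q.1).continuous 0 q.2.1 q.2.2).symm
  rw [e]
  exact (h0.comp (contDiff_fst.prodMk (contDiff_snd.comp contDiff_snd))).sub
    (h0.comp (contDiff_fst.prodMk (contDiff_fst.comp contDiff_snd)))

theorem contDiff_moment_period (k : ℕ) (hx : ContDiff ℝ ∞ (Function.uncurry x))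
    (hy : ContDiff ℝ ∞ (Function.uncurry y)) :
    ContDiff ℝ ∞ fun e => moment k (x e) (y e) 0 1 :=
  (contDiff_moment_family k hx hy).comp
    (contDiff_id.prodMk (contDiff_const (c := ((0 : ℝ), (1 : ℝ)))))

theorem contDiff_gramDet (hx : ContDiff ℝ ∞ (Function.uncurry x)) :
    ContDiff ℝ ∞ fun e => gramDet (x e) :=
  ((contDiff_moment_period 0 hx (contDiff_corrector_family 0 hx)).mul
    (contDiff_moment_period 1 hx (contDiff_corrector_family 1 hx))).sub
    ((contDiff_moment_period 1 hx (contDiff_corrector_family 0 hx)).pow 2)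

theorem contDiffAt_coeffZero (hx : ContDiff ℝ ∞ (Function.uncurry x))
    (hy : ContDiff ℝ ∞ (Function.uncurry y)) {e : E} (he : gramDet (x e) ≠ 0) :
    ContDiffAt ℝ ∞ (fun e => coeffZero (x e) (y e)) e :=
  (((contDiff_moment_period 0 hx hy).mul
    (contDiff_moment_period 1 hx (contDiff_corrector_family 1 hx))).sub
    ((contDiff_moment_period 1 hx hy).mul
      (contDiff_moment_period 1 hx (contDiff_corrector_family 0 hx)))).contDiffAt.div
    (contDiff_gramDet hx).contDiffAt he

theorem contDiffAt_coeffOne (hx : ContDiff ℝ ∞ (Function.uncurry x))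
    (hy : ContDiff ℝ ∞ (Function.uncurry y)) {e : E} (he : gramDet (x e) ≠ 0) :
    ContDiffAt ℝ ∞ (fun e => coeffOne (x e) (y e)) e :=
  (((contDiff_moment_period 0 hx (contDiff_corrector_family 0 hx)).mul
    (contDiff_moment_period 1 hx hy)).sub
    ((contDiff_moment_period 1 hx (contDiff_corrector_family 0 hx)).mul
      (contDiff_moment_period 0 hx hy))).contDiffAt.div
    (contDiff_gramDet hx).contDiffAt he

theorem contDiffAt_balance (hx : ContDiff ℝ ∞ (Function.uncurry x))
    (hy : ContDiff ℝ ∞ (Function.uncurry y)) {q : E × ℝ} (he : gramDet (x q.1) ≠ 0) :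
    ContDiffAt ℝ ∞ (fun q : E × ℝ => balance (x q.1) (y q.1) q.2) q :=
  (hy.contDiffAt.sub (((contDiffAt_coeffZero hx hy he).comp q contDiffAt_fst).mul
    (contDiff_corrector_family 0 hx).contDiffAt)).sub
    (((contDiffAt_coeffOne hx hy he).comp q contDiffAt_fst).mul
      (contDiff_corrector_family 1 hx).contDiffAt)

theorem contDiffAt_moment_balance (k : ℕ) (hx : ContDiff ℝ ∞ (Function.uncurry x))
    (hy : ContDiff ℝ ∞ (Function.uncurry y)) {q : E × ℝ × ℝ} (he : gramDet (x q.1) ≠ 0) :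
    ContDiffAt ℝ ∞
      (fun q : E × ℝ × ℝ => moment k (x q.1) (balance (x q.1) (y q.1)) q.2.1 q.2.2) q := by
  have hxe : ∀ e, ContDiff ℝ ∞ (x e) := fun e => hx.comp (contDiff_const.prodMk contDiff_id)
  have hye : ∀ e, ContDiff ℝ ∞ (y e) := fun e => hy.comp (contDiff_const.prodMk contDiff_id)
  simp_rw [fun e a b => moment_balance k (hxe e) (hye e).continuous a b]
  exact ((contDiff_moment_family k hx hy).contDiffAt.sub
    (((contDiffAt_coeffZero hx hy he).comp q contDiffAt_fst).mul
      (contDiff_moment_family k hx (contDiff_corrector_family 0 hx)).contDiffAt)).sub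
    (((contDiffAt_coeffOne hx hy he).comp q contDiffAt_fst).mul
      (contDiff_moment_family k hx (contDiff_corrector_family 1 hx)).contDiffAt)

theorem contDiffAt_response (hx : ContDiff ℝ ∞ (Function.uncurry x))
    (hy : ContDiff ℝ ∞ (Function.uncurry y)) {q : E × ℝ × ℝ} (he : gramDet (x q.1) ≠ 0) :
    ContDiffAt ℝ ∞ (fun q : E × ℝ × ℝ => response (x q.1) (y q.1) q.2.1 q.2.2) q := by
  have hs : ContDiff ℝ ∞ fun q : E × ℝ × ℝ => (q.1, q.2.1) := by fun_prop
  have hsh : ContDiff ℝ ∞ fun q : E × ℝ × ℝ => (q.1, q.2.1 + q.2.2) := by fun_prop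
  have hssh : ContDiff ℝ ∞ fun q : E × ℝ × ℝ => (q.1, q.2.1, q.2.1 + q.2.2) := by fun_prop
  have h1 := ContDiffAt.comp q (g := fun q : E × ℝ => balance (x q.1) (y q.1) q.2)
    (contDiffAt_balance hx hy (q := (q.1, q.2.1 + q.2.2)) he) hsh.contDiffAt
  have h2 := ContDiffAt.comp q (g := fun q : E × ℝ => balance (x q.1) (y q.1) q.2)
    (contDiffAt_balance hx hy (q := (q.1, q.2.1)) he) hs.contDiffAt
  have h3 : ∀ k, _ := fun k => ContDiffAt.comp q
    (g := fun q : E × ℝ × ℝ => moment k (x q.1) (balance (x q.1) (y q.1)) q.2.1 q.2.2)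
    (contDiffAt_moment_balance k hx hy (q := (q.1, q.2.1, q.2.1 + q.2.2)) he) hssh.contDiffAt
  rw [contDiffAt_pi]
  intro i
  fin_cases i
  · exact h1.sub h2
  · exact h3 0
  · exact h3 1

/-- Absence of double points is stable, including near the diagonal. -/
theorem eventually_not_isDoublePoint (hx : ContDiff ℝ ∞ (Function.uncurry x))
    (hy : ContDiff ℝ ∞ (Function.uncurry y)) {e₀ : E} {s₀ h₀ : ℝ}
    (he : IsPlaneLoop (x e₀) (y e₀)) (hd : h₀ = 0 ∨ ¬ IsDoublePoint (x e₀) (y e₀) s₀ h₀) :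
    ∀ᶠ q : E × ℝ × ℝ in 𝓝 (e₀, s₀, h₀),
      0 < q.2.2 → ¬ IsDoublePoint (x q.1) (y q.1) q.2.1 q.2.2 := by
  have hg := he.gramDet_pos.ne'
  rcases hd with rfl | hd
  · by_cases h0 : deriv (x e₀) s₀ = 0
    · have hb : ContDiffAt ℝ ∞ (Function.uncurry fun e => balance (x e) (y e)) (e₀, s₀) :=
        contDiffAt_balance hx hy hg
      have h1 : deriv (balance (x e₀) (y e₀)) s₀ ≠ 0 := he.balanced.immersed s₀ h0
      filter_upwards [eventually_ne_of_deriv_ne_zero (f := fun e => balance (x e) (y e))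
        (hb.deriv_param.1.eventually_ne h1) hb.deriv_param.2] with q hq hpos hdp
      exact hq hpos hdp.2.1
    · have hb := hx.contDiffAt (x := (e₀, s₀))
      filter_upwards [eventually_ne_of_deriv_ne_zero (f := x)
        (hb.deriv_param.1.eventually_ne h0) hb.deriv_param.2] with q hq hpos hdp
      exact hq hpos hdp.1
  · rw [isDoublePoint_iff, not_and_or] at hd
    rcases hd with hd | hd
    · have hc : Continuous fun q : E × ℝ × ℝ => x q.1 (q.2.1 + q.2.2) - x q.1 q.2.1 :=
        (hx.continuous.comp (by fun_prop : Continuous fun q : E × ℝ × ℝ =>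
          (q.1, q.2.1 + q.2.2))).sub (hx.continuous.comp
          (by fun_prop : Continuous fun q : E × ℝ × ℝ => (q.1, q.2.1)))
      filter_upwards [hc.continuousAt.eventually_ne hd] with q hq _ hdp
      exact hq (isDoublePoint_iff.1 hdp).1
    · filter_upwards [(contDiffAt_response hx hy (q := (e₀, s₀, h₀)) hg).continuousAt.eventually_ne
        hd] with q hq _ hdp
      exact hq (isDoublePoint_iff.1 hdp).2

/-- The matrix of responses to three functions. -/
noncomputable def responseDet (x : ℝ → ℝ) (η : Fin 3 → ℝ → ℝ) (s h : ℝ) : ℝ :=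
  (Matrix.of fun i j => response x (η j) s h i).det

theorem continuousAt_responseDet (hx : ContDiff ℝ ∞ (Function.uncurry x)) {η : Fin 3 → ℝ → ℝ}
    (hη : ∀ j, ContDiff ℝ ∞ (η j)) {q : E × ℝ × ℝ} (he : gramDet (x q.1) ≠ 0) :
    ContinuousAt (fun q : E × ℝ × ℝ => responseDet (x q.1) η q.2.1 q.2.2) q := by
  have hm : ContinuousAt (fun q : E × ℝ × ℝ => (Matrix.of fun i j =>
      response (x q.1) (η j) q.2.1 q.2.2 i : Matrix (Fin 3) (Fin 3) ℝ)) q := by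
    refine continuousAt_pi.2 fun i => continuousAt_pi.2 fun j => ?_
    exact continuousAt_pi.1 (contDiffAt_response (y := fun _ => η j) hx
      ((hη j).comp contDiff_snd) he).continuousAt i
  exact (continuous_id.matrix_det (n := Fin 3) (R := ℝ)).continuousAt.comp hm

theorem exists_sum_response_eq {x : ℝ → ℝ} {η : Fin 3 → ℝ → ℝ} {s h : ℝ}
    (hd : responseDet x η s h ≠ 0) (v : Fin 3 → ℝ) :
    ∃ w : Fin 3 → ℝ, ∑ j, w j • response x (η j) s h = v := by
  have hu : IsUnit (Matrix.of fun i j => response x (η j) s h i) :=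
    (Matrix.isUnit_iff_isUnit_det _).2 hd.isUnit
  obtain ⟨w, hw⟩ := Matrix.mulVec_surjective_iff_isUnit.2 hu v
  refine ⟨w, ?_⟩
  rw [← hw]
  ext i
  simp [Matrix.mulVec, dotProduct, mul_comm]

end Family

/-- A smooth bump function on the circle supported in an arc. -/
theorem exists_arc_bump {a b : ℝ} (hab : a < b) (hb : b < a + 1) :
    ∃ g : ℝ → ℝ, ContDiff ℝ ∞ g ∧ Function.Periodic g 1 ∧ (∀ s, 0 ≤ g s) ∧
      (∀ s ∈ Ioo a b, 0 < g s) ∧ ∀ s ∈ Icc b (a + 1), g s = 0 := by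
  have hπ := Real.pi_pos
  refine ⟨fun u => expNegInvGlue (Real.cos (2 * Real.pi * (u - (a + b) / 2))
    - Real.cos (Real.pi * (b - a))), ?_, fun u => ?_, fun _ => expNegInvGlue.nonneg _,
    fun u hu => ?_, fun u hu => ?_⟩
  · refine expNegInvGlue.contDiff.comp ?_
    exact (Real.contDiff_cos.comp (by fun_prop)).sub contDiff_const
  · simp only
    rw [show 2 * Real.pi * (u + 1 - (a + b) / 2)
      = 2 * Real.pi * (u - (a + b) / 2) + 2 * Real.pi by ring, Real.cos_add_two_pi]
  · refine expNegInvGlue.pos_of_pos (sub_pos.2 ?_)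
    rw [← Real.cos_abs (2 * Real.pi * (u - (a + b) / 2))]
    refine Real.cos_lt_cos_of_nonneg_of_le_pi (abs_nonneg _) (by nlinarith) ?_
    rw [abs_lt]
    constructor <;> nlinarith [hu.1, hu.2]
  · refine expNegInvGlue.zero_of_nonpos (sub_nonpos.2 ?_)
    rcases le_total (u - (a + b) / 2) (1 / 2) with hle | hge
    · exact Real.cos_le_cos_of_nonneg_of_le_pi (by nlinarith) (by nlinarith) (by nlinarith [hu.1])
    · rw [← Real.cos_two_pi_sub (2 * Real.pi * (u - (a + b) / 2))]
      exact Real.cos_le_cos_of_nonneg_of_le_pi (by nlinarith) (by nlinarith) (by nlinarith [hu.2])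

/-- The zeroth and first moments over an arc can be prescribed by functions supported in it. -/
theorem exists_moments_eq {x : ℝ → ℝ} (hx : ContDiff ℝ ∞ x) (hp : Function.Periodic x 1)
    {a b c : ℝ} (hb : b < a + 1) (hc : c ∈ Ioo a b) (hxc : deriv x c ≠ 0) (m₀ m₁ : ℝ) :
    ∃ η : ℝ → ℝ, ContDiff ℝ ∞ η ∧ Function.Periodic η 1 ∧ (∀ s ∈ Icc b (a + 1), η s = 0) ∧
      moment 0 x η a b = m₀ ∧ moment 1 x η a b = m₁ := by
  obtain ⟨g, hg, hgp, hg0, hgpos, hgz⟩ := exists_arc_bump (hc.1.trans hc.2) hb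
  have hgram := (gram_pos hx hg.continuous hg0 hc (hgpos c hc) hxc).ne'
  set A := ∫ u in a..b, g u * deriv x u ^ 4
  set B := ∫ u in a..b, g u * x u * deriv x u ^ 4
  set C := ∫ u in a..b, g u * x u ^ 2 * deriv x u ^ 4
  have hk : ∀ j, ContDiff ℝ ∞ fun u => g u * corrector j x u := fun j =>
    hg.mul (contDiff_corrector hx j)
  have h00 : moment 0 x (fun u => g u * corrector 0 x u) a b = A :=
    integral_congr fun u _ => by simp only [corrector]; ring
  have h01 : moment 0 x (fun u => g u * corrector 1 x u) a b = B :=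
    integral_congr fun u _ => by simp only [corrector]; ring
  have h10 : moment 1 x (fun u => g u * corrector 0 x u) a b = B :=
    integral_congr fun u _ => by simp only [corrector]; ring
  have h11 : moment 1 x (fun u => g u * corrector 1 x u) a b = C :=
    integral_congr fun u _ => by simp only [corrector]; ring
  have hm : ∀ k (α β : ℝ), moment k x (fun u => 0 + α * (g u * corrector 0 x u)
      + β * (g u * corrector 1 x u)) a b
      = α * moment k x (fun u => g u * corrector 0 x u) a b
        + β * moment k x (fun u => g u * corrector 1 x u) a b := fun k α β => by
    have hc : Continuous fun u => 0 + α * (g u * corrector 0 x u) :=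
      continuous_const.add (continuous_const.mul (hk 0).continuous)
    rw [moment_add_mul k hx hc (hk 1).continuous,
      moment_add_mul k hx continuous_const (hk 0).continuous]
    simp [moment]
  refine ⟨fun u => 0 + (m₀ * C - m₁ * B) / (A * C - B ^ 2) * (g u * corrector 0 x u)
    + (A * m₁ - B * m₀) / (A * C - B ^ 2) * (g u * corrector 1 x u),
    (contDiff_const.add (contDiff_const.mul (hk 0))).add (contDiff_const.mul (hk 1)),
    fun u => ?_, fun u hu => ?_, ?_, ?_⟩
  · simp only [corrector, hgp u, hp u, hp.deriv_of_periodic u]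
  · simp [hgz u hu]
  · rw [hm, h00, h01, div_mul_eq_mul_div, div_mul_eq_mul_div, ← add_div, div_eq_iff hgram]
    ring
  · rw [hm, h10, h11, div_mul_eq_mul_div, div_mul_eq_mul_div, ← add_div, div_eq_iff hgram]
    ring

theorem one_sub_cos_pos {h : ℝ} (h0 : 0 < h) (h1 : h < 1) : 0 < 1 - Real.cos (2 * Real.pi * h) := by
  have hπ := Real.pi_pos
  have hs : 0 < Real.sin (Real.pi * h) :=
    Real.sin_pos_of_pos_of_lt_pi (by positivity) (by nlinarith)
  rw [show 2 * Real.pi * h = 2 * (Real.pi * h) by ring, Real.cos_two_mul, Real.cos_sq']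
  nlinarith [pow_pos hs 2]

theorem moment_period {x η : ℝ → ℝ} (k : ℕ) (hp : Function.Periodic x 1)
    (hη : Function.Periodic η 1) (s : ℝ) : moment k x η 0 1 = moment k x η s (s + 1) := by
  have hper : Function.Periodic (fun u => η u * x u ^ k * deriv x u) 1 := fun u => by
    simp only [hp u, hη u, hp.deriv_of_periodic u]
  simpa [moment] using hper.intervalIntegral_add_eq 0 s

/-- At a double point every response is attained. -/
theorem IsPlaneLoop.exists_response_eq {x y : ℝ → ℝ} (hp : IsPlaneLoop x y) {s h : ℝ} (h0 : 0 < h)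
    (h1 : h < 1) (hd : balance x y (s + h) = balance x y s) (v : Fin 3 → ℝ) :
    ∃ η : ℝ → ℝ, ContDiff ℝ ∞ η ∧ Function.Periodic η 1 ∧ response x η s h = v := by
  have hx := hp.smooth_fst
  have hB := hp.balanced
  obtain ⟨c, hc, hc0⟩ := exists_deriv_eq_zero (by linarith : s < s + h)
    hB.smooth_snd.continuous.continuousOn hd.symm
  obtain ⟨c', hc', hc0'⟩ := exists_deriv_eq_zero (by linarith : s + h < s + 1)
    hB.smooth_snd.continuous.continuousOn (by rw [hd, hB.periodic_snd])
  have hcpos := one_sub_cos_pos h0 h1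
  set P : ℝ → ℝ := fun u =>
    v 0 / (1 - Real.cos (2 * Real.pi * h)) * (1 - Real.cos (2 * Real.pi * (u - s)))
  have hP : ContDiff ℝ ∞ P :=
    contDiff_const.mul (contDiff_const.sub (Real.contDiff_cos.comp (by fun_prop)))
  have hPp : Function.Periodic P 1 := fun u => by
    simp only [P]
    rw [show 2 * Real.pi * (u + 1 - s) = 2 * Real.pi * (u - s) + 2 * Real.pi by ring,
      Real.cos_add_two_pi]
  obtain ⟨η₁, hη₁, hp₁, hz₁, hm₁, hm₁'⟩ := exists_moments_eq hx hp.periodic_fst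
    (by linarith : s + h < s + 1) hc (fun h => hB.immersed c h hc0)
    (v 1 - moment 0 x P s (s + h)) (v 2 - moment 1 x P s (s + h))
  obtain ⟨η₂, hη₂, hp₂, hz₂, hm₂, hm₂'⟩ := exists_moments_eq hx hp.periodic_fst
    (by linarith : s + 1 < s + h + 1) hc' (fun h => hB.immersed c' h hc0')
    (-v 1 - moment 0 x P (s + h) (s + 1)) (-v 2 - moment 1 x P (s + h) (s + 1))
  have hz₂' : ∀ u ∈ Icc s (s + h), η₂ u = 0 := fun u hu => by
    rw [← hp₂ u]
    exact hz₂ _ ⟨by linarith [hu.1], by linarith [hu.2]⟩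
  have hzero : ∀ k (ζ : ℝ → ℝ) (a b : ℝ), a ≤ b → (∀ u ∈ Icc a b, ζ u = 0) →
      moment k x ζ a b = 0 := fun k ζ a b hab hζ => by
    rw [moment, integral_congr (g := fun _ => 0) fun u hu => ?_, intervalIntegral.integral_zero]
    rw [uIcc_of_le hab] at hu
    simp [hζ u hu]
  set η : ℝ → ℝ := fun u => P u + 1 * η₁ u + 1 * η₂ u with hηdef
  have hη : ContDiff ℝ ∞ η := (hP.add (contDiff_const.mul hη₁)).add (contDiff_const.mul hη₂)
  have hηp : Function.Periodic η 1 := fun u => by simp only [η, hPp u, hp₁ u, hp₂ u]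
  have hm : ∀ k a b, moment k x η a b
      = moment k x P a b + moment k x η₁ a b + moment k x η₂ a b := fun k a b => by
    rw [hηdef, moment_add_mul k hx (hP.add (contDiff_const.mul hη₁)).continuous hη₂.continuous,
      moment_add_mul k hx hP.continuous hη₁.continuous, one_mul, one_mul]
  have e1 : ∀ k, moment k x η s (s + h) = moment k x P s (s + h) + moment k x η₁ s (s + h) :=
    fun k => by rw [hm, hzero k η₂ s (s + h) (by linarith) hz₂', add_zero]
  have e2 : ∀ k, moment k x η (s + h) (s + 1)
      = moment k x P (s + h) (s + 1) + moment k x η₂ (s + h) (s + 1) :=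
    fun k => by rw [hm, hzero k η₁ (s + h) (s + 1) (by linarith) hz₁, add_zero]
  have e3 : ∀ k, moment k x η 0 1 = moment k x η s (s + h) + moment k x η (s + h) (s + 1) :=
    fun k => by
      rw [moment_period k hp.periodic_fst hηp s,
        ← moment_sub k hx hη.continuous s (s + h) (s + 1)]
      ring
  have hbal : balance x η = η := balance_eq_self
    (by rw [e3, e1, e2, hm₁, hm₂]; ring) (by rw [e3, e1, e2, hm₁', hm₂']; ring)
  have hs : η s = 0 := by
    have := hz₁ (s + 1) ⟨by linarith, le_rfl⟩
    rw [hp₁] at this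
    simp [η, P, this, hz₂' s ⟨le_rfl, by linarith⟩]
  have hsh : η (s + h) = v 0 := by
    simp [η, P, hz₁ (s + h) ⟨le_rfl, by linarith⟩, hz₂' (s + h) ⟨by linarith, le_rfl⟩]
    field_simp
  refine ⟨η, hη, hηp, ?_⟩
  rw [response, hbal, e1, e1, hm₁, hm₁', hs, hsh]
  ext i
  fin_cases i <;> simp

theorem IsPlaneLoop.exists_responseDet_ne_zero {x y : ℝ → ℝ} (hp : IsPlaneLoop x y) {s h : ℝ}
    (h0 : 0 < h) (h1 : h < 1) (hd : IsDoublePoint x y s h) :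
    ∃ η : Fin 3 → ℝ → ℝ, (∀ j, ContDiff ℝ ∞ (η j)) ∧ (∀ j, Function.Periodic (η j) 1) ∧
      responseDet x η s h ≠ 0 := by
  choose η hη hηp hr using fun j : Fin 3 => hp.exists_response_eq h0 h1 hd.2.1 (Pi.single j 1)
  refine ⟨η, hη, hηp, ?_⟩
  have : (Matrix.of fun i j => response x (η j) s h i) = (1 : Matrix (Fin 3) (Fin 3) ℝ) := by
    ext i j
    simp [hr, Matrix.one_apply, Pi.single_apply]
  rw [responseDet, this, Matrix.det_one]
  exact one_ne_zero

/-- A smooth function that is positive exactly on `(0, 1)`. -/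
noncomputable def switch (t : ℝ) : ℝ := expNegInvGlue t * expNegInvGlue (1 - t)

theorem contDiff_switch : ContDiff ℝ ∞ switch :=
  expNegInvGlue.contDiff.mul (expNegInvGlue.contDiff.comp (contDiff_const.sub contDiff_id))

theorem switch_pos {t : ℝ} (ht : t ∈ Ioo (0 : ℝ) 1) : 0 < switch t :=
  mul_pos (expNegInvGlue.pos_of_pos ht.1) (expNegInvGlue.pos_of_pos (sub_pos.2 ht.2))

theorem switch_eq_zero {t : ℝ} (ht : t ∉ Ioo (0 : ℝ) 1) : switch t = 0 := by
  rcases le_or_gt t 0 with h | h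
  · simp [switch, expNegInvGlue.zero_of_nonpos h]
  · have : 1 - t ≤ 0 := sub_nonpos.2 (not_lt.1 fun h' => ht ⟨h, h'⟩)
    simp [switch, expNegInvGlue.zero_of_nonpos this]

/-- The perturbation of the first coordinate of a family of plane curves. -/
noncomputable def perturbFst (X : ℝ → ℝ → ℝ) (p : ℝ × ℝ) (t s : ℝ) : ℝ :=
  X t s + switch t * (p.1 * Real.cos (2 * Real.pi * s) + p.2 * Real.sin (2 * Real.pi * s))

/-- The perturbation of the second coordinate of a family of plane curves. -/
noncomputable def perturbSnd {κ : Type} [Fintype κ] (Y : ℝ → ℝ → ℝ) (η : κ → ℝ → ℝ) (q : κ → ℝ)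
    (t s : ℝ) : ℝ :=
  Y t s + switch t * ∑ i, q i * η i s

section Perturbation

variable {κ : Type} [Fintype κ] {X Y : ℝ → ℝ → ℝ} {η : κ → ℝ → ℝ}

theorem contDiff_perturbFst (hX : ContDiff ℝ ∞ (Function.uncurry X)) :
    ContDiff ℝ ∞ (Function.uncurry fun e : ((ℝ × ℝ) × (κ → ℝ)) × ℝ => perturbFst X e.1.1 e.2) := by
  have h1 : ContDiff ℝ ∞ fun p : (((ℝ × ℝ) × (κ → ℝ)) × ℝ) × ℝ => X p.1.2 p.2 :=
    hX.comp (by fun_prop : ContDiff ℝ ∞ fun p : (((ℝ × ℝ) × (κ → ℝ)) × ℝ) × ℝ => (p.1.2, p.2))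
  have h2 : ContDiff ℝ ∞ fun p : (((ℝ × ℝ) × (κ → ℝ)) × ℝ) × ℝ => switch p.1.2 :=
    contDiff_switch.comp (by fun_prop)
  refine h1.add (h2.mul ?_)
  fun_prop

theorem contDiff_perturbSnd (hY : ContDiff ℝ ∞ (Function.uncurry Y))
    (hη : ∀ i, ContDiff ℝ ∞ (η i)) :
    ContDiff ℝ ∞
      (Function.uncurry fun e : ((ℝ × ℝ) × (κ → ℝ)) × ℝ => perturbSnd Y η e.1.2 e.2) := by
  have h1 : ContDiff ℝ ∞ fun p : (((ℝ × ℝ) × (κ → ℝ)) × ℝ) × ℝ => Y p.1.2 p.2 :=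
    hY.comp (by fun_prop : ContDiff ℝ ∞ fun p : (((ℝ × ℝ) × (κ → ℝ)) × ℝ) × ℝ => (p.1.2, p.2))
  have h2 : ContDiff ℝ ∞ fun p : (((ℝ × ℝ) × (κ → ℝ)) × ℝ) × ℝ => switch p.1.2 :=
    contDiff_switch.comp (by fun_prop)
  refine h1.add (h2.mul (ContDiff.sum fun i _ => ContDiff.mul ?_ ?_))
  · fun_prop
  · exact (hη i).comp contDiff_snd

theorem perturbFst_of_switch {p : ℝ × ℝ} {t : ℝ} (ht : switch t = 0) :
    perturbFst X p t = X t := by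
  funext s
  simp [perturbFst, ht]

theorem perturbSnd_of_switch {q : κ → ℝ} {t : ℝ} (ht : switch t = 0) :
    perturbSnd Y η q t = Y t := by
  funext s
  simp [perturbSnd, ht]

theorem perturbFst_zero (t : ℝ) : perturbFst X 0 t = X t := by
  funext s
  simp [perturbFst]

theorem perturbSnd_zero (t : ℝ) : perturbSnd Y η 0 t = Y t := by
  funext s
  simp [perturbSnd]

theorem periodic_perturbFst {t : ℝ} (h : Function.Periodic (X t) 1) (p : ℝ × ℝ) :
    Function.Periodic (perturbFst X p t) 1 := fun s => by
  simp only [perturbFst, h s, mul_add, mul_one, Real.cos_add_two_pi, Real.sin_add_two_pi]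

theorem periodic_perturbSnd {t : ℝ} (h : Function.Periodic (Y t) 1)
    (hη : ∀ i, Function.Periodic (η i) 1) (q : κ → ℝ) :
    Function.Periodic (perturbSnd Y η q t) 1 := fun s => by
  simp only [perturbSnd, h s, hη _ s]

/-- Small perturbations of a family of plane loops are families of plane loops. -/
theorem eventually_isPlaneLoop_perturb (hX : ContDiff ℝ ∞ (Function.uncurry X))
    (hY : ContDiff ℝ ∞ (Function.uncurry Y)) (hη : ∀ i, ContDiff ℝ ∞ (η i))
    (hηp : ∀ i, Function.Periodic (η i) 1) (hXY : ∀ t, IsPlaneLoop (X t) (Y t)) :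
    ∀ᶠ a : (ℝ × ℝ) × (κ → ℝ) in 𝓝 0,
      ∀ t, IsPlaneLoop (perturbFst X a.1 t) (perturbSnd Y η a.2 t) := by
  have hx := contDiff_perturbFst (κ := κ) hX
  have hy := contDiff_perturbSnd hY hη
  have hloc : ∀ k ∈ Icc (0 : ℝ) 1 ×ˢ Icc (0 : ℝ) 1,
      ∀ᶠ z : ((ℝ × ℝ) × (κ → ℝ)) × (ℝ × ℝ) in 𝓝 (0, k),
        (deriv (perturbFst X z.1.1 z.2.1) z.2.2, deriv (perturbSnd Y η z.1.2 z.2.1) z.2.2)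
          ≠ (0, 0) := by
    intro k _
    have hm : Continuous fun z : ((ℝ × ℝ) × (κ → ℝ)) × (ℝ × ℝ) => ((z.1, z.2.1), z.2.2) := by
      fun_prop
    have hc := ((contDiff_deriv_param hx).continuous.comp hm).prodMk
      ((contDiff_deriv_param hy).continuous.comp hm)
    refine hc.continuousAt.eventually_ne ?_
    simp only [Function.comp, Prod.fst_zero, Prod.snd_zero, perturbFst_zero, perturbSnd_zero, ne_eq,
      Prod.mk.injEq, not_and]
    exact (hXY k.1).immersed k.2
  have hev := (isCompact_Icc.prod isCompact_Icc).eventually_forall_of_forall_eventually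
    (P := fun (a : (ℝ × ℝ) × (κ → ℝ)) (k : ℝ × ℝ) =>
      (deriv (perturbFst X a.1 k.1) k.2, deriv (perturbSnd Y η a.2 k.1) k.2) ≠ (0, 0)) hloc
  filter_upwards [hev] with a ha t
  by_cases ht : t ∈ Ioo (0 : ℝ) 1
  · have px := periodic_perturbFst (hXY t).periodic_fst a.1
    have py := periodic_perturbSnd (hXY t).periodic_snd hηp a.2
    refine ⟨hx.comp (contDiff_const (c := (a, t)).prodMk contDiff_id),
      hy.comp (contDiff_const (c := (a, t)).prodMk contDiff_id), px, py, fun s h1 h2 => ?_⟩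
    refine ha (t, Int.fract s) ⟨⟨ht.1.le, ht.2.le⟩, Int.fract_nonneg s, (Int.fract_lt_one s).le⟩ ?_
    simp only [px.deriv_of_periodic.map_fract, py.deriv_of_periodic.map_fract, h1, h2]
  · rw [perturbFst_of_switch (switch_eq_zero ht), perturbSnd_of_switch (switch_eq_zero ht)]
    exact hXY t

end Perturbation

/-- Finitely many triples of functions detect all double points of a family of plane loops. -/
theorem exists_detecting_triples {X Y : ℝ → ℝ → ℝ} (hX : ContDiff ℝ ∞ (Function.uncurry X))
    (hY : ContDiff ℝ ∞ (Function.uncurry Y)) (hXY : ∀ t, IsPlaneLoop (X t) (Y t)) :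
    ∃ (ι : Type) (_ : Fintype ι) (η : ι → Fin 3 → ℝ → ℝ), (∀ i j, ContDiff ℝ ∞ (η i j)) ∧
      (∀ i j, Function.Periodic (η i j) 1) ∧ ∀ t ∈ Icc (0 : ℝ) 1, ∀ s ∈ Icc (0 : ℝ) 1,
        ∀ h ∈ Ioc (0 : ℝ) (1 / 2), IsDoublePoint (X t) (Y t) s h →
          ∃ i, responseDet (X t) (η i) s h ≠ 0 := by
  have hloc : ∀ u ∈ Icc (0 : ℝ) 1 ×ˢ Icc (0 : ℝ) 1 ×ˢ Icc (0 : ℝ) (1 / 2),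
      ∃ U ∈ 𝓝 u, ∃ η : Fin 3 → ℝ → ℝ, (∀ j, ContDiff ℝ ∞ (η j)) ∧
        (∀ j, Function.Periodic (η j) 1) ∧ ∀ v ∈ U, 0 < v.2.2 →
          IsDoublePoint (X v.1) (Y v.1) v.2.1 v.2.2 → responseDet (X v.1) η v.2.1 v.2.2 ≠ 0 := by
    rintro ⟨t, s, h⟩ ⟨-, -, hh0, hh1⟩
    simp only at hh0 hh1
    by_cases hd : h = 0 ∨ ¬ IsDoublePoint (X t) (Y t) s h
    · exact ⟨_, eventually_not_isDoublePoint hX hY (hXY t) hd, fun _ _ => 0,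
        fun _ => contDiff_const, fun _ _ => rfl, fun v hv hpos hdp => absurd hdp (hv hpos)⟩
    · rw [not_or, not_not] at hd
      obtain ⟨η, hη, hηp, hdet⟩ := (hXY t).exists_responseDet_ne_zero
        (lt_of_le_of_ne hh0 (Ne.symm hd.1)) (by linarith) hd.2
      exact ⟨_, (continuousAt_responseDet hX hη (q := (t, s, h))
        (hXY t).gramDet_pos.ne').eventually_ne hdet, η, hη, hηp, fun v hv _ _ => hv⟩
  choose U hU η hη hηp hdet using hloc
  obtain ⟨T, hT⟩ := (isCompact_Icc.prod (isCompact_Icc.prod isCompact_Icc)).elim_nhds_subcover' U hU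
  refine ⟨T, inferInstance, fun i => η i.1.1 i.1.2, fun i => hη i.1.1 i.1.2,
    fun i => hηp i.1.1 i.1.2, fun t ht s hs h hh hd => ?_⟩
  obtain ⟨u, hu, hmem⟩ := mem_iUnion₂.1 (hT ⟨ht, hs, hh.1.le, hh.2⟩ : (t, s, h) ∈ _)
  exact ⟨⟨u, hu⟩, hdet u.1 u.2 (t, s, h) hmem hh.1 hd⟩

/-- A derivative is computed by an affine restriction to a line. -/
theorem HasFDerivAt.apply_eq_of_affine {E G : Type*} [NormedAddCommGroup E] [NormedSpace ℝ E]
    [NormedAddCommGroup G] [NormedSpace ℝ G] {F : E → G} {F' : E →L[ℝ] G} {q v : E} {c : G}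
    (hF : HasFDerivAt F F' q) (h : ∀ τ : ℝ, F (q + τ • v) = F q + τ • c) : F' v = c := by
  have h1 : HasDerivAt (fun τ : ℝ => q + τ • v) v 0 := by
    simpa using ((hasDerivAt_id (0 : ℝ)).smul_const v).const_add q
  have h2 : HasDerivAt (fun τ : ℝ => F (q + τ • v)) (F' v) 0 :=
    HasFDerivAt.comp_hasDerivAt (0 : ℝ) (by simpa using hF) h1
  have h3 : HasDerivAt (fun τ : ℝ => F q + τ • c) c 0 := by
    simpa using ((hasDerivAt_id (0 : ℝ)).smul_const c).const_add (F q)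
  simp only [h] at h2
  exact h2.unique h3

section Transversality

variable {ι : Type} [Fintype ι] {X Y : ℝ → ℝ → ℝ} {η : ι → Fin 3 → ℝ → ℝ}

/-- The equations for a double point in the universal family of perturbations. -/
noncomputable def defect (X Y : ℝ → ℝ → ℝ) (η : ι → Fin 3 → ℝ → ℝ)
    (q : (((ℝ × ℝ) × (ι × Fin 3 → ℝ)) × ℝ) × ℝ × ℝ) : ℝ × (Fin 3 → ℝ) :=
  (perturbFst X q.1.1.1 q.1.2 (q.2.1 + q.2.2) - perturbFst X q.1.1.1 q.1.2 q.2.1,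
    response (perturbFst X q.1.1.1 q.1.2)
      (perturbSnd Y (fun i : ι × Fin 3 => η i.1 i.2) q.1.1.2 q.1.2) q.2.1 q.2.2)

theorem contDiffAt_defect (hX : ContDiff ℝ ∞ (Function.uncurry X))
    (hY : ContDiff ℝ ∞ (Function.uncurry Y)) (hη : ∀ i j, ContDiff ℝ ∞ (η i j))
    {q : (((ℝ × ℝ) × (ι × Fin 3 → ℝ)) × ℝ) × ℝ × ℝ}
    (hq : gramDet (perturbFst X q.1.1.1 q.1.2) ≠ 0) : ContDiffAt ℝ ∞ (defect X Y η) q := by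
  have hx := contDiff_perturbFst (κ := ι × Fin 3) hX
  have hy := contDiff_perturbSnd (κ := ι × Fin 3) (η := fun i => η i.1 i.2) hY fun i => hη i.1 i.2
  refine ContDiffAt.prodMk (ContDiff.contDiffAt (ContDiff.sub ?_ ?_)) (contDiffAt_response hx hy hq)
  · exact hx.comp (by fun_prop : ContDiff ℝ ∞
      fun q : (((ℝ × ℝ) × (ι × Fin 3 → ℝ)) × ℝ) × ℝ × ℝ => (q.1, q.2.1 + q.2.2))
  · exact hx.comp (by fun_prop : ContDiff ℝ ∞
      fun q : (((ℝ × ℝ) × (ι × Fin 3 → ℝ)) × ℝ) × ℝ × ℝ => (q.1, q.2.1))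

theorem surjective_defect_deriv (hX : ContDiff ℝ ∞ (Function.uncurry X))
    (hY : ContDiff ℝ ∞ (Function.uncurry Y)) (hη : ∀ i j, ContDiff ℝ ∞ (η i j))
    {q : (((ℝ × ℝ) × (ι × Fin 3 → ℝ)) × ℝ) × ℝ × ℝ}
    {F' : ((((ℝ × ℝ) × (ι × Fin 3 → ℝ)) × ℝ) × ℝ × ℝ) →L[ℝ] ℝ × (Fin 3 → ℝ)}
    (hF : HasFDerivAt (defect X Y η) F' q) (ht : q.1.2 ∈ Ioo (0 : ℝ) 1)
    (hh : q.2.2 ∈ Ioo (0 : ℝ) 1) {i : ι}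
    (hi : responseDet (perturbFst X q.1.1.1 q.1.2) (η i) q.2.1 q.2.2 ≠ 0) :
    Function.Surjective F' := by
  classical
  obtain ⟨⟨⟨p, r⟩, t⟩, s, h⟩ := q
  simp only at ht hh hi
  have hx : ContDiff ℝ ∞ (perturbFst X p t) := (contDiff_perturbFst (κ := ι × Fin 3) hX).comp
    (contDiff_const (c := ((p, r), t)).prodMk contDiff_id)
  have hy : ContDiff ℝ ∞ (perturbSnd Y (fun i : ι × Fin 3 => η i.1 i.2) r t) :=
    (contDiff_perturbSnd (κ := ι × Fin 3) hY fun i => hη i.1 i.2).comp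
      (contDiff_const (c := ((p, r), t)).prodMk contDiff_id)
  have hχ := switch_pos ht
  have hcos := one_sub_cos_pos hh.1 hh.2
  have hsnd : ∀ β : Fin 3 → ℝ, ∃ v, F' v = (0, β) := fun β => by
    obtain ⟨w, hw⟩ := exists_sum_response_eq hi β
    let W : ι × Fin 3 → ℝ := fun k => if k.1 = i then (switch t)⁻¹ * w k.2 else 0
    refine ⟨(((0, W), 0), 0, 0), hF.apply_eq_of_affine fun τ => ?_⟩
    have hc : ∀ k : ι × Fin 3, Continuous (η k.1 k.2) := fun k => (hη k.1 k.2).continuous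
    have hsum : response (perturbFst X p t)
        (fun u => ∑ k : ι × Fin 3, switch t * W k * η k.1 k.2 u) s h = β := by
      rw [response_sum (η := fun k : ι × Fin 3 => η k.1 k.2) hx hc, Fintype.sum_prod_type,
        Finset.sum_eq_single i, ← hw]
      · refine Finset.sum_congr rfl fun j _ => ?_
        simp [W, hχ.ne']
      · intro k _ hk
        simp [W, hk]
      · simp
    have e : perturbSnd Y (fun i : ι × Fin 3 => η i.1 i.2) (r + τ • W) t = fun u =>
        perturbSnd Y (fun i : ι × Fin 3 => η i.1 i.2) r t u
          + τ * ∑ k : ι × Fin 3, switch t * W k * η k.1 k.2 u := by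
      funext u
      simp only [perturbSnd, Pi.add_apply, Pi.smul_apply, smul_eq_mul, add_mul,
        Finset.sum_add_distrib, mul_add, Finset.mul_sum, add_assoc]
      congr 2
      exact Finset.sum_congr rfl fun k _ => by ring
    have hc' : Continuous fun u => ∑ k : ι × Fin 3, switch t * W k * η k.1 k.2 u :=
      continuous_finsetSum _ fun k _ => continuous_const.mul (hc k)
    simp only [defect, Prod.smul_mk, Prod.mk_add_mk, smul_zero, add_zero, e,
      response_add_mul hx hy.continuous hc', hsum]
  have hfst : ∃ v, (F' v).1 ≠ 0 := by
    let A := Real.cos (2 * Real.pi * (s + h)) - Real.cos (2 * Real.pi * s)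
    let B := Real.sin (2 * Real.pi * (s + h)) - Real.sin (2 * Real.pi * s)
    refine ⟨((((A, B), 0), 0), 0, 0), ?_⟩
    have h1 : HasFDerivAt (fun q => (defect X Y η q).1)
        ((ContinuousLinearMap.fst ℝ ℝ (Fin 3 → ℝ)).comp F') (((p, r), t), s, h) :=
      HasFDerivAt.fst hF
    have h2 := h1.apply_eq_of_affine (v := ((((A, B), 0), 0), 0, 0))
      (c := switch t * (A * A + B * B)) fun τ => by
        simp only [defect, perturbFst, Prod.smul_mk, Prod.mk_add_mk, smul_eq_mul, mul_zero,
          add_zero, Prod.fst_add, Prod.snd_add, A, B]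
        ring
    have h3 : A * A + B * B = 2 * (1 - Real.cos (2 * Real.pi * h)) := by
      have c1 := Real.cos_sq_add_sin_sq (2 * Real.pi * s)
      have c2 := Real.cos_sq_add_sin_sq (2 * Real.pi * (s + h))
      have c3 := Real.cos_sub (2 * Real.pi * (s + h)) (2 * Real.pi * s)
      rw [show 2 * Real.pi * (s + h) - 2 * Real.pi * s = 2 * Real.pi * h by ring] at c3
      simp only [A, B]
      linear_combination c1 + c2 + 2 * c3
    rw [show (F' ((((A, B), 0), 0), 0, 0)).1 = switch t * (A * A + B * B) from h2, h3]
    positivity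
  obtain ⟨v, hv⟩ := hfst
  rintro ⟨α, β⟩
  obtain ⟨v', hv'⟩ := hsnd (β - (α / (F' v).1) • (F' v).2)
  refine ⟨(α / (F' v).1) • v + v', ?_⟩
  rw [map_add, map_smul, hv']
  ext <;> simp [hv]

end Transversality

section Generic

variable {ι : Type} [Fintype ι] {X Y : ℝ → ℝ → ℝ} {η : ι → Fin 3 → ℝ → ℝ}

/-- Double points of small perturbations are still detected by the given triples. -/
theorem eventually_responseDet_ne_zero (hX : ContDiff ℝ ∞ (Function.uncurry X))
    (hY : ContDiff ℝ ∞ (Function.uncurry Y)) (hXY : ∀ t, IsPlaneLoop (X t) (Y t))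
    (hη : ∀ i j, ContDiff ℝ ∞ (η i j))
    (hdet : ∀ t ∈ Icc (0 : ℝ) 1, ∀ s ∈ Icc (0 : ℝ) 1, ∀ h ∈ Ioc (0 : ℝ) (1 / 2),
      IsDoublePoint (X t) (Y t) s h → ∃ i, responseDet (X t) (η i) s h ≠ 0) :
    ∀ᶠ a : (ℝ × ℝ) × (ι × Fin 3 → ℝ) in 𝓝 0,
      ∀ k ∈ Icc (0 : ℝ) 1 ×ˢ Icc (0 : ℝ) 1 ×ˢ Icc (0 : ℝ) (1 / 2), 0 < k.2.2 →
        IsDoublePoint (perturbFst X a.1 k.1)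
          (perturbSnd Y (fun i : ι × Fin 3 => η i.1 i.2) a.2 k.1) k.2.1 k.2.2 →
        ∃ i, responseDet (perturbFst X a.1 k.1) (η i) k.2.1 k.2.2 ≠ 0 := by
  have hx := contDiff_perturbFst (κ := ι × Fin 3) hX
  have hy := contDiff_perturbSnd (κ := ι × Fin 3) (η := fun i => η i.1 i.2) hY fun i => hη i.1 i.2
  refine (isCompact_Icc.prod (isCompact_Icc.prod
    isCompact_Icc)).eventually_forall_of_forall_eventually ?_
  rintro ⟨t, s, h⟩ ⟨ht, hs, hh0, hh1⟩
  simp only at ht hs hh0 hh1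
  have hm : ContinuousAt (fun z : ((ℝ × ℝ) × (ι × Fin 3 → ℝ)) × (ℝ × ℝ × ℝ) =>
      ((z.1, z.2.1), z.2.2.1, z.2.2.2)) (0, t, s, h) := by fun_prop
  have e1 : perturbFst X 0 t = X t := perturbFst_zero t
  have e2 : perturbSnd Y (fun i : ι × Fin 3 => η i.1 i.2) 0 t = Y t := perturbSnd_zero t
  have hp : IsPlaneLoop (perturbFst X 0 t)
      (perturbSnd Y (fun i : ι × Fin 3 => η i.1 i.2) 0 t) := by
    rw [e1, e2]
    exact hXY t
  by_cases hd : h = 0 ∨ ¬ IsDoublePoint (X t) (Y t) s h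
  · rw [← e1, ← e2] at hd
    filter_upwards [hm.eventually (eventually_not_isDoublePoint hx hy
      (e₀ := (((0, 0), t) : ((ℝ × ℝ) × (ι × Fin 3 → ℝ)) × ℝ)) hp hd)] with z hz hpos hdp
    exact absurd hdp (hz hpos)
  · rw [not_or, not_not] at hd
    obtain ⟨i, hi⟩ := hdet t ht s hs h ⟨lt_of_le_of_ne hh0 (Ne.symm hd.1), hh1⟩ hd.2
    rw [← e1] at hi
    filter_upwards [hm.eventually ((continuousAt_responseDet hx (hη i)
      (q := (((0, t), s, h) : (((ℝ × ℝ) × (ι × Fin 3 → ℝ)) × ℝ) × ℝ × ℝ))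
      hp.gramDet_pos.ne').eventually_ne hi)] with z hz _ _
    exact ⟨i, hz⟩

/-- For a dense set of parameters the perturbation has no double points, as soon as double points
are detected by the given triples. -/
theorem dense_setOf_not_isDoublePoint (hX : ContDiff ℝ ∞ (Function.uncurry X))
    (hY : ContDiff ℝ ∞ (Function.uncurry Y)) (hη : ∀ i j, ContDiff ℝ ∞ (η i j))
    {S : Set ((ℝ × ℝ) × (ι × Fin 3 → ℝ))}
    (hS : ∀ a ∈ S, ∀ t, IsPlaneLoop (perturbFst X a.1 t)
      (perturbSnd Y (fun i : ι × Fin 3 => η i.1 i.2) a.2 t))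
    (hdet : ∀ a ∈ S, ∀ k ∈ Icc (0 : ℝ) 1 ×ˢ Icc (0 : ℝ) 1 ×ˢ Icc (0 : ℝ) (1 / 2), 0 < k.2.2 →
      IsDoublePoint (perturbFst X a.1 k.1)
        (perturbSnd Y (fun i : ι × Fin 3 => η i.1 i.2) a.2 k.1) k.2.1 k.2.2 →
      ∃ i, responseDet (perturbFst X a.1 k.1) (η i) k.2.1 k.2.2 ≠ 0) :
    Dense {a | a ∈ S → ∀ t ∈ Ioo (0 : ℝ) 1, ∀ s ∈ Icc (0 : ℝ) 1, ∀ h ∈ Ioc (0 : ℝ) (1 / 2),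
      ¬ IsDoublePoint (perturbFst X a.1 t)
        (perturbSnd Y (fun i : ι × Fin 3 => η i.1 i.2) a.2 t) s h} := by
  let Z : Set ((((ℝ × ℝ) × (ι × Fin 3 → ℝ)) × ℝ) × ℝ × ℝ) :=
    {q | q.1.1 ∈ S ∧ q.1.2 ∈ Ioo (0 : ℝ) 1 ∧ q.2.1 ∈ Icc (0 : ℝ) 1 ∧ q.2.2 ∈ Ioc (0 : ℝ) (1 / 2) ∧
      IsDoublePoint (perturbFst X q.1.1.1 q.1.2)
        (perturbSnd Y (fun i : ι × Fin 3 => η i.1 i.2) q.1.1.2 q.1.2) q.2.1 q.2.2}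
  have hF : ∀ q ∈ Z, HasStrictFDerivAt (defect X Y η) (fderiv ℝ (defect X Y η) q) q :=
    fun q hq => (contDiffAt_defect hX hY hη (hS _ hq.1 _).gramDet_pos.ne').hasStrictFDerivAt
      (by simp)
  have hZ : dimH Z ≤ (Fintype.card (ι × Fin 3) + 1 : ℕ) := by
    refine dimH_regular_zeros_le (F := defect X Y η) ?_ hF (fun q hq => ?_) fun q hq => ?_
    · simp only [Module.finrank_prod, Module.finrank_self, Module.finrank_fintype_fun_eq_card,
        Fintype.card_fin]
      ring
    · have := isDoublePoint_iff.1 hq.2.2.2.2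
      exact Prod.ext this.1 this.2
    · obtain ⟨hqS, ht, hs, hh, hdp⟩ := hq
      obtain ⟨i, hi⟩ := hdet _ hqS (q.1.2, q.2.1, q.2.2) ⟨⟨ht.1.le, ht.2.le⟩, hs, hh.1.le, hh.2⟩
        hh.1 hdp
      exact surjective_defect_deriv hX hY hη (hF q ⟨hqS, ht, hs, hh, hdp⟩).hasFDerivAt ht
        ⟨hh.1, by linarith [hh.2]⟩ hi
  have hlip : LipschitzWith 1
      fun q : (((ℝ × ℝ) × (ι × Fin 3 → ℝ)) × ℝ) × ℝ × ℝ => q.1.1 := by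
    simpa [Function.comp_def] using LipschitzWith.prod_fst.comp LipschitzWith.prod_fst
  have hlt : dimH ((fun q : (((ℝ × ℝ) × (ι × Fin 3 → ℝ)) × ℝ) × ℝ × ℝ => q.1.1) '' Z)
      < Module.finrank ℝ ((ℝ × ℝ) × (ι × Fin 3 → ℝ)) := by
    refine (hlip.dimH_image_le Z).trans_lt (hZ.trans_lt ?_)
    simp only [Module.finrank_prod, Module.finrank_self, Module.finrank_fintype_fun_eq_card]
    exact_mod_cast (by omega)
  refine (dense_compl_of_dimH_lt_finrank hlt).mono fun a ha haS t ht s hs h hh hdp =>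
    (mem_compl_iff _ _).1 ha ?_
  exact ⟨((a, t), s, h), ⟨haS, ht, hs, hh, hdp⟩, rfl⟩

end Generic

/-- A smooth family of plane loops can be perturbed, with fixed ends, to one whose horizontal lifts
are embedded. -/
theorem exists_family_not_isDoublePoint {X Y : ℝ → ℝ → ℝ}
    (hX : ContDiff ℝ ∞ (Function.uncurry X)) (hY : ContDiff ℝ ∞ (Function.uncurry Y))
    (hXY : ∀ t, IsPlaneLoop (X t) (Y t)) :
    ∃ X' Y' : ℝ → ℝ → ℝ, ContDiff ℝ ∞ (Function.uncurry X') ∧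
      ContDiff ℝ ∞ (Function.uncurry Y') ∧ (∀ t, IsPlaneLoop (X' t) (Y' t)) ∧
      (∀ t ∉ Ioo (0 : ℝ) 1, X' t = X t ∧ Y' t = Y t) ∧
      ∀ t ∈ Ioo (0 : ℝ) 1, ∀ s ∈ Icc (0 : ℝ) 1, ∀ h ∈ Ioc (0 : ℝ) (1 / 2),
        ¬ IsDoublePoint (X' t) (Y' t) s h := by
  obtain ⟨ι, _, η, hη, hηp, hdet⟩ := exists_detecting_triples hX hY hXY
  have hev := (eventually_isPlaneLoop_perturb (κ := ι × Fin 3) hX hY (fun i => hη i.1 i.2)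
    (fun i => hηp i.1 i.2) hXY).and (eventually_responseDet_ne_zero hX hY hXY hη hdet)
  obtain ⟨a, haS, ha⟩ := (dense_setOf_not_isDoublePoint hX hY hη (S := {a | _ ∧ _})
    (fun a ha => ha.1) fun a ha => ha.2).inter_nhds_nonempty hev
  have hm : ContDiff ℝ ∞ fun p : ℝ × ℝ => ((a, p.1), p.2) := by fun_prop
  exact ⟨perturbFst X a.1, perturbSnd Y (fun i : ι × Fin 3 => η i.1 i.2) a.2,
    (contDiff_perturbFst hX).comp hm,
    (contDiff_perturbSnd (η := fun i : ι × Fin 3 => η i.1 i.2) hY fun i => hη i.1 i.2).comp hm,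
    ha.1,
    fun t ht => ⟨perturbFst_of_switch (switch_eq_zero ht),
      perturbSnd_of_switch (switch_eq_zero ht)⟩, haS ha⟩

/-- Horizontal lifts of a smooth family of plane loops depend smoothly on the parameter. -/
theorem contDiff_horizontalLift {X Y : ℝ → ℝ → ℝ} {z w : ℝ → ℝ}
    (hX : ContDiff ℝ ∞ (Function.uncurry X)) (hY : ContDiff ℝ ∞ (Function.uncurry Y))
    (hXY : ∀ t, IsPlaneLoop (X t) (Y t)) (hz : ContDiff ℝ ∞ z) (hw : ContDiff ℝ ∞ w) :
    ContDiff ℝ ∞ (Function.uncurry fun t => horizontalLift (X t) (Y t) (z t) (w t)) := by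
  have hb : ContDiff ℝ ∞ fun p : ℝ × ℝ => balance (X p.1) (Y p.1) p.2 :=
    contDiff_iff_contDiffAt.2 fun p => contDiffAt_balance hX hY (hXY p.1).gramDet_pos.ne'
  have hm : ∀ k, ContDiff ℝ ∞ fun p : ℝ × ℝ => moment k (X p.1) (balance (X p.1) (Y p.1)) 0 p.2 :=
    fun k => (contDiff_iff_contDiffAt.2 fun q : ℝ × ℝ × ℝ => contDiffAt_moment_balance k hX hY
      (hXY q.1).gramDet_pos.ne').comp
      (by fun_prop : ContDiff ℝ ∞ fun p : ℝ × ℝ => (p.1, (0 : ℝ), p.2))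
  have hz' : ContDiff ℝ ∞ fun p : ℝ × ℝ => z p.1 := hz.comp contDiff_fst
  have hw' : ContDiff ℝ ∞ fun p : ℝ × ℝ => w p.1 := hw.comp contDiff_fst
  have hX0 : ContDiff ℝ ∞ fun p : ℝ × ℝ => X p.1 0 :=
    hX.comp (by fun_prop : ContDiff ℝ ∞ fun p : ℝ × ℝ => (p.1, (0 : ℝ)))
  exact hX.prodMk (hb.prodMk ((hz'.add (hm 0)).prodMk
    (((hw'.add ((hz'.add (hm 0)).mul hX)).sub (hz'.mul hX0)).sub (hm 1))))

theorem exists_isHorizontalIsotopy {γ₀ γ₁ : ℝ → ℝ × ℝ × ℝ × ℝ} (h₀ : IsHorizontalLoop γ₀)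
    (h₁ : IsHorizontalLoop γ₁) {n : ℤ} (hr₀ : HasRotationNumber γ₀ n)
    (hr₁ : HasRotationNumber γ₁ n) :
    ∃ H : ℝ → ℝ → ℝ × ℝ × ℝ × ℝ, IsHorizontalIsotopy H ∧ H 0 = γ₀ ∧ H 1 = γ₁ := by
  obtain ⟨θ₀, hθ₀, hn₀⟩ := hr₀.exists_isAngle h₀
  obtain ⟨θ₁, hθ₁, hn₁⟩ := hr₁.exists_isAngle h₁
  obtain ⟨H, hH, hP, hH0, hH1⟩ := h₀.isPlaneLoop.joined h₁.isPlaneLoop hθ₀ hθ₁ hn₀ hn₁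
  obtain ⟨X, Y, hX, hY, hXY, hends, hd⟩ := exists_family_not_isDoublePoint
    (X := fun t s => (H t s).1) (Y := fun t s => (H t s).2) (contDiff_fst.comp hH)
    (contDiff_snd.comp hH) hP
  have e0 := hends 0 (by simp)
  have e1 := hends 1 (by simp)
  rw [hH0 0 le_rfl] at e0
  rw [hH1 1 le_rfl] at e1
  set L : ℝ → ℝ → ℝ × ℝ × ℝ × ℝ := fun t => horizontalLift (X t) (Y t)
    ((1 - t) * (γ₀ 0).2.2.1 + t * (γ₁ 0).2.2.1) ((1 - t) * (γ₀ 0).2.2.2 + t * (γ₁ 0).2.2.2)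
  have hL0 : L 0 = γ₀ := by
    simp only [L, e0.1, e0.2, sub_zero, one_mul, zero_mul, add_zero]
    exact h₀.lift_eq
  have hL1 : L 1 = γ₁ := by
    simp only [L, e1.1, e1.2, sub_self, one_mul, zero_mul, zero_add]
    exact h₁.lift_eq
  refine ⟨L, ⟨(contDiff_horizontalLift hX hY hXY (by fun_prop) (by fun_prop)).contDiffOn,
    fun t ht => ?_⟩, hL0, hL1⟩
  rcases eq_endpoints_or_mem_Ioo_of_mem_Icc ht with rfl | rfl | ht
  · rwa [hL0]
  · rwa [hL1]
  · exact (hXY t).isHorizontalLoop_lift _ _ (hd t ht)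

end

/-- Two horizontal loops in the standard Engel space are horizontally isotopic
if and only if their rotation numbers agree. -/
theorem horizontal_loops_isotopic_iff_rot_eq
    (γ₀ γ₁ : ℝ → ℝ × ℝ × ℝ × ℝ) (n₀ n₁ : ℤ)
    (h₀ : IsHorizontalLoop γ₀) (h₁ : IsHorizontalLoop γ₁)
    (hr₀ : HasRotationNumber γ₀ n₀) (hr₁ : HasRotationNumber γ₁ n₁) :
    (∃ H : ℝ → ℝ → ℝ × ℝ × ℝ × ℝ,
        IsHorizontalIsotopy H ∧ H 0 = γ₀ ∧ H 1 = γ₁) ↔ n₀ = n₁ := by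
  constructor
  · rintro ⟨H, hH, rfl, rfl⟩
    exact hH.rot_eq hr₀ hr₁
  · rintro rfl
    exact exists_isHorizontalIsotopy h₀ h₁ hr₀ hr₁
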